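/- Under conditions (A1)–(A3), the normalized log-spacing of the k-th largest order statistic, ζ_n := −√k (log X_{(k)} − log b(n/k)), converges in distribution as n → ∞ to a centered normal distribution with variance α^{−2}(1 + ω). -/

import Mathlib

open MeasureTheory ProbabilityTheory Filter Set
open scoped ProbabilityTheory

noncomputable section

namespace TailCusum

variable {Ω : Type*} [MeasureSpace Ω]

/-- `φ₁(x) = 1{x > 0}`. -/
def phi1 (x : ℝ) : ℝ := if 0 < x then 1 else 0

/-- `φ₂(x) = x₊ = max {x, 0}`. -/
def phi2 (x : ℝ) : ℝ := max x 0

/-- positive part -/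
def pos (x : ℝ) : ℝ := max x 0

/-- A positive measurable function `g` is regularly varying at `∞` with index `ρ` if
`g(λ x)/g(x) → λ^ρ` as `x → ∞` for every `λ > 0`. -/
def RegularlyVarying (g : ℝ → ℝ) (ρ : ℝ) : Prop :=
  Measurable g ∧ ∀ lam : ℝ, 0 < lam →
    Tendsto (fun x => g (lam * x) / g x) atTop (nhds (lam ^ ρ))

/-- `l` is slowly varying at `∞`. -/
def SlowlyVarying (l : ℝ → ℝ) : Prop :=
  Measurable l ∧ ∀ lam : ℝ, 0 < lam →
    Tendsto (fun x => l (lam * x) / l x) atTop (nhds 1)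

/-- `κ(λ) = K ∫_1^λ t^(γ-1) dt`. -/
def kappaFun (K γ : ℝ) (lam : ℝ) : ℝ := K * ∫ t in (1:ℝ)..lam, t ^ (γ - 1)

/-- Second-order regular variation condition on the slowly varying function `l`
(the core of condition (A2)): `(l(λx)/l(x) - 1)/g(x) → κ(λ)` with
`κ(λ) = K ∫_1^λ t^(γ-1) dt`, `g` positive and regularly varying with index `γ ≤ 0`. -/
def SecondOrderRV (l g : ℝ → ℝ) (K γ : ℝ) : Prop :=
  γ ≤ 0 ∧ (∀ x, 0 < g x) ∧ RegularlyVarying g γ ∧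
  ∀ lam : ℝ, 0 < lam →
    Tendsto (fun x => (l (lam * x) / l x - 1) / g x) atTop (nhds (kappaFun K γ lam))

/-- distribution function of a law on `ℝ` -/
def df (μ : Measure ℝ) (x : ℝ) : ℝ := (μ (Iic x)).toReal

/-- tail distribution function `F̄(x) = μ(x, ∞)` -/
def tailDF (μ : Measure ℝ) (x : ℝ) : ℝ := (μ (Ioi x)).toReal

/-- the quantile-type function `b(x) = inf {y : F(y) ≥ 1 - x⁻¹}` -/
def quantileB (μ : Measure ℝ) (x : ℝ) : ℝ := sInf {y : ℝ | 1 - x⁻¹ ≤ df μ y}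

/-- `F̄(x) = x^(-α) l(x)` for `x > 0` with `l` slowly varying: Pareto-type tail. -/
def ParetoTail (μ : Measure ℝ) (α : ℝ) (l : ℝ → ℝ) : Prop :=
  SlowlyVarying l ∧ ∀ x : ℝ, 0 < x → tailDF μ x = x ^ (-α) * l x

/-- strict stationarity of a sequence of random variables -/
def IsStationary (X : ℕ → Ω → ℝ) : Prop :=
  ∀ j : ℕ,
    Measure.map (fun ω => fun i : ℕ => X (i + j) ω) (ℙ : Measure Ω)
      = Measure.map (fun ω => fun i : ℕ => X i ω) (ℙ : Measure Ω)

/-- strict stationarity, `ℤ`-indexed -/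
def IsStationaryZ (X : ℤ → Ω → ℝ) : Prop :=
  ∀ j : ℤ,
    Measure.map (fun ω => fun i : ℤ => X (i + j) ω) (ℙ : Measure Ω)
      = Measure.map (fun ω => fun i : ℤ => X i ω) (ℙ : Measure Ω)

/-- The β-mixing coefficient of the sequence `X` at lag `lag`, expressed as
the supremum over `m` of the total-variation distance between the joint law of
`(X_1, …, X_m)` and `(X_{m+lag+1}, X_{m+lag+2}, …)` and the product of the two laws. -/
def betaMix (X : ℕ → Ω → ℝ) (lag : ℕ) : ℝ :=
  ⨆ m : ℕ, ⨆ S : Subtype (MeasurableSet : Set ((Fin m → ℝ) × (ℕ → ℝ)) → Prop),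
    |((Measure.map
        (fun ω => ((fun i : Fin m => X ((i : ℕ) + 1) ω, fun i : ℕ => X (m + lag + 1 + i) ω)))
        (ℙ : Measure Ω)) S.1).toReal
      - (((Measure.map (fun ω => fun i : Fin m => X ((i : ℕ) + 1) ω) (ℙ : Measure Ω)).prod
          (Measure.map (fun ω => fun i : ℕ => X (m + lag + 1 + i) ω) (ℙ : Measure Ω))) S.1).toReal|

/-- The tail sample fraction condition: `k → ∞` and `k = o(n)`. -/
def TailFraction (k : ℕ → ℕ) : Prop :=
  Tendsto (fun n : ℕ => (k n : ℝ)) atTop atTop ∧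
    Tendsto (fun n : ℕ => (k n : ℝ) / n) atTop (nhds 0)

/-- Condition (A1): `(n / r_n) β([ε r_n]) → 0` for every `ε > 0`, and `r_n² = o(k)`. -/
def CondA1 (X : ℕ → Ω → ℝ) (k r : ℕ → ℕ) : Prop :=
  (∀ n, 0 < r n) ∧
  (∀ ε : ℝ, 0 < ε →
    Tendsto (fun n : ℕ => ((n : ℝ) / r n) * betaMix X ⌊ε * r n⌋₊) atTop (nhds 0)) ∧
  Tendsto (fun n : ℕ => ((r n : ℝ) ^ 2 / k n)) atTop (nhds 0)

/-- Condition (A2): second-order regular variation of `l` plus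
`√k · g(b(n/k)) → A ∈ ℝ`. -/
def CondA2 (l g : ℝ → ℝ) (K γ A : ℝ) (b : ℝ → ℝ) (k : ℕ → ℕ) : Prop :=
  SecondOrderRV l g K γ ∧
    Tendsto (fun n : ℕ => Real.sqrt (k n) * g (b ((n : ℝ) / k n))) atTop (nhds A)

/-- covariance of two real random variables -/
def cov (f g : Ω → ℝ) : ℝ :=
  ∫ ω, (f ω - ∫ ω', f ω') * (g ω - ∫ ω', g ω')

/-- pairs `1 ≤ i < j ≤ N` -/
def pairsUpTo (N : ℕ) : Finset (ℕ × ℕ) :=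
  ((Finset.Icc 1 N) ×ˢ (Finset.Icc 1 N)).filter fun p => p.1 < p.2

/-- Condition (A3): existence of the limits `χ` and `ω` of the normalized sums of
covariances, for every `0 < ε < 1`. -/
def CondA3 (X : ℕ → Ω → ℝ) (b : ℝ → ℝ) (k r : ℕ → ℕ) (α χ ωc : ℝ) : Prop :=
  0 ≤ χ ∧ 0 ≤ ωc ∧
  ∀ ε : ℝ, 0 < ε → ε < 1 →
    (Tendsto (fun n : ℕ =>
        (2 * α ^ 2 * n / ((⌊ε * r n⌋₊ : ℝ) * k n)) *
          ∑ p ∈ pairsUpTo ⌊ε * r n⌋₊,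
            cov (fun ω => pos (Real.log (X p.1 ω) - Real.log (b ((n : ℝ) / k n))))
                (fun ω => pos (Real.log (X p.2 ω) - Real.log (b ((n : ℝ) / k n)))))
      atTop (nhds χ)) ∧
    (Tendsto (fun n : ℕ =>
        (2 * (n : ℝ) / ((⌊ε * r n⌋₊ : ℝ) * k n)) *
          ∑ p ∈ pairsUpTo ⌊ε * r n⌋₊,
            cov (fun ω => if b ((n : ℝ) / k n) < X p.1 ω then (1 : ℝ) else 0)
                (fun ω => if b ((n : ℝ) / k n) < X p.2 ω then (1 : ℝ) else 0))
      atTop (nhds ωc))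

/-- the `k`-th largest value among `X_1, …, X_n` -/
def orderStat (n k : ℕ) (X : ℕ → Ω → ℝ) (ω : Ω) : ℝ :=
  sInf {x : ℝ | ((Finset.Icc 1 n).filter fun i => x < X i ω).card < k}

/-- `|Σ_{i=1}^l Y_i - (l/n) Σ_{i=1}^n Y_i|` -/
def cusumAt (n : ℕ) (Y : ℕ → ℝ) (l : ℕ) : ℝ :=
  |∑ i ∈ Finset.Icc 1 l, Y i - ((l : ℝ) / n) * ∑ i ∈ Finset.Icc 1 n, Y i|

/-- The cusum statistic `T_n(φ)` with random threshold `X_(k)`. -/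
def cusum (n k : ℕ) (X : ℕ → Ω → ℝ) (φ : ℝ → ℝ) (ω : Ω) : ℝ :=
  (Real.sqrt k)⁻¹ *
    ⨆ l ∈ Finset.Icc 1 n,
      cusumAt n (fun i => φ (Real.log (X i ω) - Real.log (orderStat n k X ω))) l

/-- The cusum statistic with deterministic threshold `b(n/k)`. -/
def cusumDet (n k : ℕ) (X : ℕ → Ω → ℝ) (φ : ℝ → ℝ) (b : ℝ → ℝ) (ω : Ω) : ℝ :=
  (Real.sqrt k)⁻¹ *
    ⨆ l ∈ Finset.Icc 1 n,
      cusumAt n (fun i => φ (Real.log (X i ω) - Real.log (b ((n : ℝ) / k)))) l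

/-- convergence in distribution (weak convergence of laws) of real random variables to
a real random variable `Z` defined on a possibly different probability space -/
def TendstoInDist {Ω' : Type*} [MeasureSpace Ω'] (Y : ℕ → Ω → ℝ) (Z : Ω' → ℝ) : Prop :=
  ∀ f : ℝ → ℝ, Continuous f → (∃ C, ∀ x, |f x| ≤ C) →
    Tendsto (fun n : ℕ => ∫ ω, f (Y n ω)) atTop (nhds (∫ ω, f (Z ω)))

/-- convergence in distribution to a law `μ` on `ℝ` -/
def TendstoInLaw (Y : ℕ → Ω → ℝ) (μ : Measure ℝ) : Prop :=
  ∀ f : ℝ → ℝ, Continuous f → (∃ C, ∀ x, |f x| ≤ C) →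
    Tendsto (fun n : ℕ => ∫ ω, f (Y n ω)) atTop (nhds (∫ x, f x ∂μ))

/-- bounded in probability (`O_P(1)`) -/
def BddInProb (Y : ℕ → Ω → ℝ) : Prop :=
  ∀ ε : ℝ, 0 < ε → ∃ C : ℝ, ∀ᶠ n in atTop,
    ((ℙ : Measure Ω) {ω | C < |Y n ω|}).toReal < ε

/-- divergence to `+∞` in probability -/
def DivergesInProb (Y : ℕ → Ω → ℝ) : Prop :=
  ∀ C : ℝ, Tendsto (fun n : ℕ => ((ℙ : Measure Ω) {ω | Y n ω ≤ C}).toReal) atTop (nhds 0)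

/-- standard Brownian motion on `[0, ∞)` -/
structure IsStdBrownianMotion {Ω' : Type*} [MeasureSpace Ω'] (B : ℝ → Ω' → ℝ) : Prop where
  isProb : IsProbabilityMeasure (ℙ : Measure Ω')
  meas : ∀ t, Measurable (B t)
  start : ∀ᵐ ω ∂(ℙ : Measure Ω'), B 0 ω = 0
  gauss_incr : ∀ s t : ℝ, 0 ≤ s → s ≤ t →
    Measure.map (fun ω => B t ω - B s ω) (ℙ : Measure Ω')
      = gaussianReal 0 (Real.toNNReal (t - s))
  indep_incr : ∀ (n : ℕ) (ts : ℕ → ℝ), (∀ i, 0 ≤ ts i) → Monotone ts →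
    iIndepFun (m := fun _ => Real.measurableSpace)
      (fun i : Fin n => fun ω => B (ts ((i : ℕ) + 1)) ω - B (ts (i : ℕ)) ω)
      (ℙ : Measure Ω')

/-- `sup_{0 ≤ t ≤ 1} |B°(t)|` where `B°(t) = B(t) - t B(1)` is the Brownian bridge
associated with the Brownian motion `B` -/
def supAbsBrownianBridge {Ω' : Type*} [MeasureSpace Ω'] (B : ℝ → Ω' → ℝ) (ω : Ω') : ℝ :=
  ⨆ t : Icc (0 : ℝ) 1, |B (t : ℝ) ω - (t : ℝ) * B 1 ω|

/-- `A_i(ζ) = φ(log X_i - log b(n/k) + ζ/√k)` -/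
def An (X : ℕ → Ω → ℝ) (b : ℝ → ℝ) (φ : ℝ → ℝ) (n k : ℕ) (ζ : ℝ) (i : ℕ) (ω : Ω) : ℝ :=
  φ (Real.log (X i ω) - Real.log (b ((n : ℝ) / k)) + ζ / Real.sqrt k)

/-- the tail sequential process `M_n(t, ζ) = k^{-1/2} Σ_{i=1}^{[nt]} (A_i(ζ) - E A_1(ζ))` -/
def Mn (X : ℕ → Ω → ℝ) (b : ℝ → ℝ) (φ : ℝ → ℝ) (n k : ℕ) (t ζ : ℝ) (ω : Ω) : ℝ :=
  (Real.sqrt k)⁻¹ * ∑ i ∈ Finset.Icc 1 ⌊(n : ℝ) * t⌋₊,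
    (An X b φ n k ζ i ω - ∫ ω', An X b φ n k ζ 1 ω')

/-- residual `ξ̂_i = X_i - Σ_{j=1}^p φ̂_j X_{i-j}` of an AR(p) fit -/
def residual (p : ℕ) (X : ℤ → Ω → ℝ) (φh : Ω → Fin p → ℝ) (i : ℕ) (ω : Ω) : ℝ :=
  X i ω - ∑ j : Fin p, φh ω j * X ((i : ℤ) - ((j : ℕ) + 1)) ω

/-- absolute residual `Ẑ_i = |ξ̂_i|` -/
def Zhat (p : ℕ) (X : ℤ → Ω → ℝ) (φh : Ω → Fin p → ℝ) (i : ℕ) (ω : Ω) : ℝ :=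
  |residual p X φh i ω|

/-- stationarity of the restriction of `Y` to the segment of indices `[a, b]` -/
def SegStationary (a b : ℕ) (Y : ℕ → Ω → ℝ) : Prop :=
  ∀ (m : ℕ) (s : Fin m → ℕ) (j : ℕ), (∀ q, a ≤ s q ∧ s q + j ≤ b) →
    Measure.map (fun ω => fun q : Fin m => Y (s q + j) ω) (ℙ : Measure Ω)
      = Measure.map (fun ω => fun q : Fin m => Y (s q) ω) (ℙ : Measure Ω)

/-- the row-wise mixing coefficient
`β_n(l) = sup_m sup {|P(A∩B) - P(A)P(B)| : A ∈ σ(Y_i : m+l+1 ≤ i ≤ n), B ∈ σ(Y_1,…,Y_m)}` -/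
def betaMixRow (n : ℕ) (Y : ℕ → Ω → ℝ) (lag : ℕ) : ℝ :=
  ⨆ m : ℕ, ⨆ As : Subtype (MeasurableSet : Set (Fin (n - (m + lag)) → ℝ) → Prop),
    ⨆ Bs : Subtype (MeasurableSet : Set (Fin m → ℝ) → Prop),
      |((ℙ : Measure Ω)
          (((fun ω => fun i : Fin (n - (m + lag)) => Y (m + lag + 1 + (i : ℕ)) ω) ⁻¹' As.1)
            ∩ ((fun ω => fun i : Fin m => Y ((i : ℕ) + 1) ω) ⁻¹' Bs.1))).toReal
        - ((ℙ : Measure Ω)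
            ((fun ω => fun i : Fin (n - (m + lag)) => Y (m + lag + 1 + (i : ℕ)) ω) ⁻¹' As.1)).toReal
          * ((ℙ : Measure Ω)
            ((fun ω => fun i : Fin m => Y ((i : ℕ) + 1) ω) ⁻¹' Bs.1)).toReal|

open scoped Topology

lemma eventually_exists_common_small_point {φ ψ : ℕ → ℝ → ℝ} {u : ℕ → ℝ}
    (hφm : ∀ n, Measurable (φ n)) (hψm : ∀ n, Measurable (ψ n))
    (hφ : ∀ t, Tendsto (fun n => φ n t) atTop (𝓝 0))
    (hψ : ∀ t, Tendsto (fun n => ψ n t) atTop (𝓝 0))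
    (hu : Tendsto u atTop (𝓝 0)) {ε : ℝ} (hε : 0 < ε) :
    ∀ᶠ n in atTop, ∃ t ∈ Icc (0 : ℝ) 1, |φ n t| ≤ ε ∧ |ψ n (t - u n)| ≤ ε := by
  have key : ∀ χ : ℕ → ℝ → ℝ, (∀ n, Measurable (χ n)) →
      (∀ t, Tendsto (fun n => χ n t) atTop (𝓝 0)) →
      ∀ᶠ n in atTop, volume ({t | ε ≤ |χ n t|} ∩ Icc (-1 : ℝ) 2) < ENNReal.ofReal (1 / 3) := by
    intro χ hm h
    have h1 : TendstoInMeasure (volume.restrict (Icc (-1 : ℝ) 2)) χ atTop (fun _ => (0 : ℝ)) :=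
      tendstoInMeasure_of_tendsto_ae (fun n => (hm n).aestronglyMeasurable)
        (Eventually.of_forall fun t => h t)
    have h2 := tendstoInMeasure_iff_norm.1 h1 ε hε
    have h3 := h2.eventually (gt_mem_nhds (show (0 : ENNReal) < ENNReal.ofReal (1 / 3) by simp))
    filter_upwards [h3] with n hn
    rw [Measure.restrict_apply (measurableSet_le measurable_const (by fun_prop))] at hn
    simpa using hn
  have hu1 : ∀ᶠ n in atTop, |u n| < 1 := by
    have := hu.abs
    rw [abs_zero] at this
    exact this.eventually (gt_mem_nhds one_pos)
  filter_upwards [key φ hφm hφ, key ψ hψm hψ, hu1] with n h1 h2 h3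
  by_contra! hcon
  set B := {t | ε ≤ |φ n t|} ∩ Icc (-1 : ℝ) 2
  set C := {t | ε ≤ |ψ n t|} ∩ Icc (-1 : ℝ) 2
  have hsub : Icc (0 : ℝ) 1 ⊆ B ∪ (fun t => t + (-u n)) ⁻¹' C := by
    intro t ht
    rw [abs_lt] at h3
    by_cases hB : |φ n t| ≤ ε
    · right
      refine ⟨?_, ?_, ?_⟩
      · have := hcon t ht hB
        simpa [← sub_eq_add_neg] using this.le
      · simp only; linarith [ht.1, h3.2]
      · simp only; linarith [ht.2, h3.1]
    · left
      exact ⟨(not_le.1 hB).le, by linarith [ht.1], by linarith [ht.2]⟩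
  have h4 := (measure_mono hsub).trans (measure_union_le (μ := volume) _ _)
  rw [measure_preimage_add_right, Real.volume_Icc] at h4
  have h5 : ENNReal.ofReal (1 - 0) < ENNReal.ofReal (1 / 3) + ENNReal.ofReal (1 / 3) :=
    h4.trans_lt (ENNReal.add_lt_add h1 h2)
  rw [← ENNReal.ofReal_add (by norm_num) (by norm_num),
    ENNReal.ofReal_lt_ofReal_iff (by norm_num)] at h5
  norm_num at h5

/-- Uniform convergence theorem along sequences for de Haan type increments. -/
lemma tendsto_increment_div_zero {h κ : ℝ → ℝ} (hh : Measurable h) (hκ : Continuous κ)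
    {x u c c' : ℕ → ℝ} (hu : Tendsto u atTop (𝓝 0)) (hc : ∀ n, 0 < c n) (hc' : ∀ n, 0 < c' n)
    (hcc : Tendsto (fun n => c' n / c n) atTop (𝓝 1))
    (h1 : ∀ t, Tendsto (fun n => (h (x n + t) - h (x n)) / c n) atTop (𝓝 (κ t)))
    (h2 : ∀ t, Tendsto (fun n => (h (x n + u n + t) - h (x n + u n)) / c' n) atTop (𝓝 (κ t))) :
    Tendsto (fun n => (h (x n + u n) - h (x n)) / c n) atTop (𝓝 0) := by
  obtain ⟨M, hM⟩ : ∃ M, ∀ t ∈ Icc (-1 : ℝ) 2, |κ t| ≤ M := by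
    obtain ⟨M, hM⟩ := isCompact_Icc.exists_bound_of_continuousOn (s := Icc (-1 : ℝ) 2) hκ.continuousOn
    exact ⟨M, fun t ht => by simpa using hM t ht⟩
  have hM0 : 0 ≤ M := (abs_nonneg _).trans (hM 0 (by constructor <;> norm_num))
  have huc := isCompact_Icc.uniformContinuousOn_of_continuous (s := Icc (-1 : ℝ) 2) hκ.continuousOn
  rw [Metric.uniformContinuousOn_iff] at huc
  rw [Metric.tendsto_nhds]
  intro ε hε
  obtain ⟨δ, hδ, hδ'⟩ := huc (ε / 5) (by positivity)
  have e1 := eventually_exists_common_small_point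
    (φ := fun n t => (h (x n + t) - h (x n)) / c n - κ t)
    (ψ := fun n t => (h (x n + u n + t) - h (x n + u n)) / c' n - κ t)
    (fun n => (((hh.comp (measurable_const.add measurable_id)).sub_const _).div_const _).sub
      hκ.measurable)
    (fun n => (((hh.comp (measurable_const.add measurable_id)).sub_const _).div_const _).sub
      hκ.measurable)
    (fun t => by simpa using (h1 t).sub_const (κ t))
    (fun t => by simpa using (h2 t).sub_const (κ t)) hu (ε := ε / 5) (by positivity)
  have e2 : ∀ᶠ n in atTop, |u n| < min δ 1 := by
    have := hu.abs
    rw [abs_zero] at this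
    exact this.eventually (gt_mem_nhds (by positivity))
  have e3 : ∀ᶠ n in atTop, |c' n / c n - 1| < min 1 (ε / (5 * (M + 1))) := by
    have := (hcc.sub_const 1).abs
    rw [sub_self, abs_zero] at this
    exact this.eventually (gt_mem_nhds (by positivity))
  filter_upwards [e1, e2, e3] with n hn1 hn2 hn3
  obtain ⟨t, ht, ha, hb⟩ := hn1
  have hn21 := hn2.trans_le (min_le_right _ _)
  have hn22 := hn2.trans_le (min_le_left _ _)
  have hn31 := hn3.trans_le (min_le_left _ _)
  have hn32 := hn3.trans_le (min_le_right _ _)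
  have hts : t - u n ∈ Icc (-1 : ℝ) 2 := by
    rw [abs_lt] at hn21
    exact ⟨by linarith [ht.1], by linarith [ht.2]⟩
  have hk1 := hM _ hts
  have hk2 : |κ t - κ (t - u n)| < ε / 5 := by
    have := hδ' t ⟨by linarith [ht.1], by linarith [ht.2]⟩ (t - u n) hts
      (by rw [Real.dist_eq]; simpa using hn22)
    simpa [Real.dist_eq] using this
  set a := (h (x n + t) - h (x n)) / c n - κ t with ha'
  set b := (h (x n + u n + (t - u n)) - h (x n + u n)) / c' n - κ (t - u n) with hb'
  set ρ := c' n / c n with hρ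
  have hrep : (h (x n + u n) - h (x n)) / c n
      = a - ρ * b + (κ t - κ (t - u n)) - (ρ - 1) * κ (t - u n) := by
    have := (hc n).ne'
    have := (hc' n).ne'
    have hxt : x n + u n + (t - u n) = x n + t := by ring
    rw [ha', hb', hρ, hxt]
    field_simp
    ring
  have hρ2 : |ρ| ≤ 2 := by
    rw [abs_lt] at hn31
    rw [abs_le]; constructor <;> linarith
  have b1 : |ρ * b| ≤ 2 * (ε / 5) := by
    rw [abs_mul]; gcongr
  have b2 : |(ρ - 1) * κ (t - u n)| ≤ ε / (5 * (M + 1)) * (M + 1) := by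
    rw [abs_mul]; gcongr; linarith
  have b3 : ε / (5 * (M + 1)) * (M + 1) = ε / 5 := by field_simp
  rw [Real.dist_eq, sub_zero, hrep]
  rw [b3] at b2
  rw [abs_le] at b1 b2 ha
  rw [abs_lt] at hk2 ⊢
  constructor <;> linarith [b1.1, b1.2, b2.1, b2.2, ha.1, ha.2, hk2.1, hk2.2]

lemma continuous_kappaFun_exp (K γ : ℝ) : Continuous fun u => kappaFun K γ (Real.exp u) := by
  unfold kappaFun
  refine continuous_const.mul ?_
  by_cases hγ : γ = 0
  · have : ∀ u : ℝ, ∫ t in (1 : ℝ)..Real.exp u, t ^ (γ - 1) = u := by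
      intro u
      have h := integral_one_div_of_pos one_pos (Real.exp_pos u)
      simp only [div_one, Real.log_exp] at h
      refine Eq.trans (intervalIntegral.integral_congr (g := fun t : ℝ => 1 / t) fun t _ => ?_) h
      simp [hγ, Real.rpow_neg_one]
    simp_rw [this]
    exact continuous_id
  · have : ∀ u : ℝ, ∫ t in (1 : ℝ)..Real.exp u, t ^ (γ - 1) = (Real.exp u ^ γ - 1) / γ := by
      intro u
      rw [integral_rpow]
      · simp
      · right
        refine ⟨fun h => hγ (by linarith), fun h => ?_⟩
        have := h.1
        have h2 : 0 < min 1 (Real.exp u) := lt_min one_pos (Real.exp_pos u)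
        exact absurd this (not_le.2 h2)
    simp_rw [this]
    refine ((Continuous.rpow_const Real.continuous_exp fun u => Or.inl (Real.exp_ne_zero u)).sub
      continuous_const).div_const _

lemma tendsto_log_increment_of_regularlyVarying {g : ℝ → ℝ} {ρ : ℝ} (hgm : Measurable g)
    (hg0 : ∀ x > 0, 0 < g x)
    (hg : ∀ lam : ℝ, 0 < lam → Tendsto (fun x => g (lam * x) / g x) atTop (𝓝 (lam ^ ρ)))
    {x u : ℕ → ℝ} (hx : Tendsto x atTop atTop) (hu : Tendsto u atTop (𝓝 0)) :
    Tendsto (fun n => g (Real.exp (x n + u n)) / g (Real.exp (x n))) atTop (𝓝 1) := by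
  have hpos : ∀ y, 0 < g (Real.exp y) := fun y => hg0 _ (Real.exp_pos y)
  have hinc : ∀ y : ℕ → ℝ, Tendsto y atTop atTop → ∀ t,
      Tendsto (fun n => (Real.log (g (Real.exp (y n + t))) - Real.log (g (Real.exp (y n)))) / 1)
        atTop (𝓝 (ρ * t)) := by
    intro y hy t
    have h := (hg (Real.exp t) (Real.exp_pos t)).comp (Real.tendsto_exp_atTop.comp hy)
    have h2 := h.log (Real.rpow_pos_of_pos (Real.exp_pos t) ρ).ne'
    rw [Real.log_rpow (Real.exp_pos t), Real.log_exp] at h2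
    refine h2.congr fun n => ?_
    simp only [Function.comp]
    rw [← Real.exp_add, add_comm t, Real.log_div (hpos _).ne' (hpos _).ne', div_one]
  have h := tendsto_increment_div_zero (h := fun y => Real.log (g (Real.exp y)))
    (κ := fun t => ρ * t) (c := fun _ => 1) (c' := fun _ => 1) (x := x) (u := u)
    (Real.measurable_log.comp (hgm.comp Real.measurable_exp)) (by fun_prop) hu
    (fun _ => one_pos) (fun _ => one_pos) (by simp) (hinc x hx)
    (hinc _ (hx.atTop_add hu))
  have h2 := (Real.continuous_exp.tendsto 0).comp h
  rw [Real.exp_zero] at h2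
  refine h2.congr fun n => ?_
  simp only [Function.comp, div_one]
  rw [Real.exp_sub, Real.exp_log (hpos _), Real.exp_log (hpos _)]

/-- If `y → 0` and `y * s → c`, then `f y * s → f' c` when `f 0 = 0` and `f'` is the derivative
of `f` at `0`. -/
lemma tendsto_comp_mul_of_hasDerivAt {ι 𝕜 : Type*} [NontriviallyNormedField 𝕜] {L : Filter ι}
    {f : 𝕜 → 𝕜} {f' : 𝕜} (hf : HasDerivAt f f' 0) (hf0 : f 0 = 0) {y s : ι → 𝕜} {c : 𝕜}
    (hy : Tendsto y L (𝓝 0)) (hys : Tendsto (fun n => y n * s n) L (𝓝 c)) :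
    Tendsto (fun n => f (y n) * s n) L (𝓝 (f' * c)) := by
  have hd : Tendsto (fun n => dslope f 0 (y n)) L (𝓝 f') := by
    have hcont := (continuousAt_dslope_same.2 hf.differentiableAt).tendsto
    rw [dslope_same, hf.deriv] at hcont
    exact hcont.comp hy
  refine (hd.mul hys).congr fun n => ?_
  have h := sub_smul_dslope f 0 (y n)
  simp only [sub_zero, smul_eq_mul, hf0] at h
  rw [← h]
  ring

/-- Uniform version of the second-order condition near `1`. -/
lemma tendsto_log_slowlyVarying_increment_div {l g : ℝ → ℝ} {K γ : ℝ}
    (hl : SlowlyVarying l) (hl0 : ∀ x > 0, 0 < l x) (h2 : SecondOrderRV l g K γ)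
    {x u : ℕ → ℝ} (hx : Tendsto x atTop atTop) (hu : Tendsto u atTop (𝓝 0)) :
    Tendsto (fun n => (Real.log (l (Real.exp (x n + u n))) - Real.log (l (Real.exp (x n))))
      / g (Real.exp (x n))) atTop (𝓝 0) := by
  obtain ⟨-, hg0, ⟨hgm, hg⟩, hlg⟩ := h2
  have hpos : ∀ y, 0 < l (Real.exp y) := fun y => hl0 _ (Real.exp_pos y)
  have hinc : ∀ y : ℕ → ℝ, Tendsto y atTop atTop → ∀ t,
      Tendsto (fun n => (Real.log (l (Real.exp (y n + t))) - Real.log (l (Real.exp (y n))))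
        / g (Real.exp (y n))) atTop (𝓝 (kappaFun K γ (Real.exp t))) := by
    intro y hy t
    have hy' := Real.tendsto_exp_atTop.comp hy
    have ha := ((hl.2 (Real.exp t) (Real.exp_pos t)).comp hy').sub_const 1
    rw [sub_self] at ha
    have hb := (hlg (Real.exp t) (Real.exp_pos t)).comp hy'
    have hder : HasDerivAt (fun t => Real.log (1 + t)) 1 (0 : ℝ) := by
      simpa using ((hasDerivAt_id (0 : ℝ)).const_add 1).log (by norm_num)
    have hab := tendsto_comp_mul_of_hasDerivAt hder (by simp) ha hb
    rw [one_mul] at hab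
    refine hab.congr fun n => ?_
    simp only [Function.comp]
    rw [← div_eq_mul_inv]
    rw [← Real.exp_add, add_comm t, add_sub_cancel, Real.log_div (hpos _).ne' (hpos _).ne']
  exact tendsto_increment_div_zero (h := fun y => Real.log (l (Real.exp y)))
    (κ := fun t => kappaFun K γ (Real.exp t)) (c := fun n => g (Real.exp (x n)))
    (c' := fun n => g (Real.exp (x n + u n)))
    (Real.measurable_log.comp (hl.1.comp Real.measurable_exp)) (continuous_kappaFun_exp K γ)
    hu (fun n => hg0 _) (fun n => hg0 _)
    (tendsto_log_increment_of_regularlyVarying hgm (fun x _ => hg0 x) hg hx hu)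
    (hinc x hx) (hinc _ (hx.atTop_add hu))

section Tail

variable {μ : Measure ℝ} [IsProbabilityMeasure μ]

lemma df_eq_one_sub_tailDF (x : ℝ) : df μ x = 1 - tailDF μ x := by
  have := prob_compl_eq_one_sub (μ := μ) (measurableSet_Ioi (a := x))
  rw [compl_Ioi] at this
  rw [df, tailDF, this, ENNReal.toReal_sub_of_le prob_le_one (by simp)]
  simp

lemma df_eq_cdf (x : ℝ) : df μ x = cdf μ x := (cdf_eq_real μ x).symm

lemma tailDF_antitone : Antitone (tailDF μ) := fun x y h => by
  have := (cdf μ).mono h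
  rw [← df_eq_cdf, ← df_eq_cdf, df_eq_one_sub_tailDF, df_eq_one_sub_tailDF] at this
  linarith

lemma tailDF_pos {α : ℝ} {l : ℝ → ℝ} (hF : ParetoTail μ α l) (x : ℝ) : 0 < tailDF μ x := by
  by_contra hcon
  have hzero : ∀ y ≥ max x 1, l y = 0 := by
    intro y hy
    have hy0 : 0 < y := lt_of_lt_of_le one_pos ((le_max_right _ _).trans hy)
    have h1 : tailDF μ y = 0 :=
      le_antisymm ((tailDF_antitone ((le_max_left _ _).trans hy)).trans (not_lt.1 hcon))
        ENNReal.toReal_nonneg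
    rw [hF.2 y hy0] at h1
    exact (mul_eq_zero.1 h1).resolve_left (Real.rpow_pos_of_pos hy0 _).ne'
  have h2 : Tendsto (fun y => l (2 * y) / l y) atTop (𝓝 0) :=
    tendsto_const_nhds.congr' (by
      filter_upwards [eventually_ge_atTop (max x 1)] with y hy
      rw [hzero y hy, div_zero])
  exact one_ne_zero (tendsto_nhds_unique (hF.1.2 2 two_pos) h2)

lemma slowlyVarying_part_pos {α : ℝ} {l : ℝ → ℝ} (hF : ParetoTail μ α l) (x : ℝ) (hx : 0 < x) :
    0 < l x := by
  have h := tailDF_pos hF x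
  rw [hF.2 x hx] at h
  exact (mul_pos_iff_of_pos_left (Real.rpow_pos_of_pos hx _)).1 h

lemma quantileB_set_eq (x : ℝ) : {y : ℝ | 1 - x⁻¹ ≤ df μ y} = {y | tailDF μ y ≤ x⁻¹} := by
  ext y
  simp only [mem_ofPred_eq, df_eq_one_sub_tailDF]
  constructor <;> intro h <;> linarith

lemma quantileB_set_nonempty {x : ℝ} (hx : 0 < x) : {y | tailDF μ y ≤ x⁻¹}.Nonempty := by
  have h := tendsto_cdf_atTop μ
  have h2 := h.eventually (lt_mem_nhds (show 1 - x⁻¹ < 1 by simpa using hx))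
  obtain ⟨y, hy⟩ := h2.exists
  refine ⟨y, ?_⟩
  rw [← df_eq_cdf, df_eq_one_sub_tailDF] at hy
  simp only [mem_ofPred_eq]
  linarith

lemma quantileB_set_bddBelow (hμ : μ (Iio 0) = 0) {x : ℝ} (hx : 1 < x) :
    BddBelow {y | tailDF μ y ≤ x⁻¹} := by
  refine ⟨0, fun y hy => ?_⟩
  by_contra! hneg
  have h1 : tailDF μ y = 1 := by
    have : df μ y = 0 := by
      rw [df, measure_mono_null (Iic_subset_Iio.2 hneg) hμ]; simp
    rw [df_eq_one_sub_tailDF] at this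
    linarith
  simp only [mem_ofPred_eq, h1] at hy
  exact absurd hy (not_le.2 (inv_lt_one_of_one_lt₀ hx))

lemma lt_tailDF_of_lt_quantileB (hμ : μ (Iio 0) = 0) {x : ℝ} (hx : 1 < x) {y : ℝ}
    (hy : y < quantileB μ x) : x⁻¹ < tailDF μ y := by
  by_contra! hcon
  rw [quantileB, quantileB_set_eq] at hy
  exact absurd (csInf_le (quantileB_set_bddBelow hμ hx) hcon) (not_le.2 hy)

lemma tailDF_quantileB_le {x : ℝ} (hx : 1 < x) :
    tailDF μ (quantileB μ x) ≤ x⁻¹ := by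
  set b := quantileB μ x with hb
  have hright : ∀ y > b, 1 - x⁻¹ ≤ cdf μ y := by
    intro y hy
    rw [hb, quantileB, quantileB_set_eq] at hy
    obtain ⟨w, hw, hwy⟩ := exists_lt_of_csInf_lt (quantileB_set_nonempty (by linarith)) hy
    have := (tailDF_antitone (μ := μ) hwy.le).trans hw
    rw [← df_eq_cdf, df_eq_one_sub_tailDF]
    linarith
  have hcont : Tendsto (cdf μ) (𝓝[>] b) (𝓝 (cdf μ b)) :=
    ((cdf μ).right_continuous b).mono_left (nhdsWithin_mono _ Ioi_subset_Ici_self)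
  have := ge_of_tendsto hcont (by filter_upwards [self_mem_nhdsWithin] with y hy using hright y hy)
  rw [← df_eq_cdf, df_eq_one_sub_tailDF] at this
  linarith

lemma tendsto_quantileB_atTop (htail : ∀ x, 0 < tailDF μ x) :
    Tendsto (quantileB μ) atTop atTop := by
  refine tendsto_atTop.2 fun M => ?_
  filter_upwards [eventually_gt_atTop 1, eventually_gt_atTop ((tailDF μ M)⁻¹)] with x hx1 hx2
  by_contra! hlt
  have h1 := (tailDF_antitone (μ := μ) hlt.le).trans (tailDF_quantileB_le hx1)
  have h2 := (inv_lt_comm₀ (htail M) (by linarith)).1 hx2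
  linarith

end Tail

section Threshold

variable {μ : Measure ℝ} [IsProbabilityMeasure μ] {α : ℝ} {l : ℝ → ℝ} {k : ℕ → ℕ}

lemma tendsto_sqrt_atTop_of_tailFraction (hk : TailFraction k) :
    Tendsto (fun n => Real.sqrt (k n)) atTop atTop :=
  Real.tendsto_sqrt_atTop.comp hk.1

lemma tendsto_ratio_atTop_of_tailFraction (hk : TailFraction k) :
    Tendsto (fun n : ℕ => (n : ℝ) / k n) atTop atTop := by
  have h : Tendsto (fun n : ℕ => (k n : ℝ) / n) atTop (𝓝[>] 0) := by
    refine tendsto_nhdsWithin_iff.2 ⟨hk.2, ?_⟩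
    filter_upwards [hk.1.eventually_gt_atTop 0, eventually_gt_atTop 0] with n h1 h2
    simp only [mem_Ioi]
    positivity
  refine h.inv_tendsto_nhdsGT_zero.congr fun n => ?_
  simp

lemma tendsto_quantileB_ratio (hF : ParetoTail μ α l) (hk : TailFraction k) :
    Tendsto (fun n : ℕ => quantileB μ ((n : ℝ) / k n)) atTop atTop :=
  (tendsto_quantileB_atTop (tailDF_pos hF)).comp (tendsto_ratio_atTop_of_tailFraction hk)

lemma log_tailDF_exp (hF : ParetoTail μ α l) (y : ℝ) :
    Real.log (tailDF μ (Real.exp y)) = -α * y + Real.log (l (Real.exp y)) := by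
  rw [hF.2 _ (Real.exp_pos y), Real.log_mul (Real.rpow_pos_of_pos (Real.exp_pos y) _).ne'
    (slowlyVarying_part_pos hF _ (Real.exp_pos y)).ne', Real.log_rpow (Real.exp_pos y),
    Real.log_exp]

lemma tendsto_log_tailDF_increment (hF : ParetoTail μ α l)
    (hk : TailFraction k) {g : ℝ → ℝ} {K γ A : ℝ} (hA2 : CondA2 l g K γ A (quantileB μ) k)
    {w : ℕ → ℝ} {z : ℝ} (hw : Tendsto w atTop (𝓝 z)) :
    Tendsto (fun n : ℕ =>
      (Real.log (tailDF μ (Real.exp (Real.log (quantileB μ ((n : ℝ) / k n))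
          - w n / Real.sqrt (k n))))
        - Real.log (tailDF μ (Real.exp (Real.log (quantileB μ ((n : ℝ) / k n))))))
      * Real.sqrt (k n)) atTop (𝓝 (α * z)) := by
  have hb := tendsto_quantileB_ratio hF hk
  have hs := tendsto_sqrt_atTop_of_tailFraction hk
  have hu : Tendsto (fun n => -(w n / Real.sqrt (k n))) atTop (𝓝 0) := by
    simpa using (hw.div_atTop hs).neg
  have hd := tendsto_log_slowlyVarying_increment_div hF.1 (slowlyVarying_part_pos hF) hA2.1
    (Real.tendsto_log_atTop.comp hb) hu
  have h := (hd.mul hA2.2).add (hw.const_mul α)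
  rw [zero_mul, zero_add] at h
  refine h.congr' ?_
  filter_upwards [hb.eventually_gt_atTop 0, hs.eventually_gt_atTop 0] with n hn1 hn2
  have hg := (hA2.1.2.1 (quantileB μ ((n : ℝ) / k n))).ne'
  simp only [Function.comp]
  rw [log_tailDF_exp hF, log_tailDF_exp hF, Real.exp_log hn1, ← sub_eq_add_neg]
  field_simp
  ring

lemma tendsto_log_expected_count_at_quantileB (hF : ParetoTail μ α l) (hμ : μ (Iio 0) = 0)
    (hk : TailFraction k) {g : ℝ → ℝ} {K γ A : ℝ} (hA2 : CondA2 l g K γ A (quantileB μ) k) :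
    Tendsto (fun n : ℕ =>
      (Real.log (tailDF μ (Real.exp (Real.log (quantileB μ ((n : ℝ) / k n)))))
        + Real.log ((n : ℝ) / k n)) * Real.sqrt (k n)) atTop (𝓝 0) := by
  have hw : Tendsto (fun n : ℕ => 1 / ((n : ℝ) + 1)) atTop (𝓝 0) :=
    tendsto_one_div_add_atTop_nhds_zero_nat
  have h := (tendsto_log_tailDF_increment hF hk hA2 hw).neg
  rw [mul_zero, neg_zero] at h
  have hb := tendsto_quantileB_ratio hF hk
  have hs := tendsto_sqrt_atTop_of_tailFraction hk
  have hr := tendsto_ratio_atTop_of_tailFraction hk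
  refine tendsto_of_tendsto_of_tendsto_of_le_of_le' h tendsto_const_nhds ?_ ?_
  · filter_upwards [hb.eventually_gt_atTop 0, hs.eventually_gt_atTop 0, hr.eventually_gt_atTop 1]
      with n h1 h2 h3
    rw [← neg_mul]
    refine mul_le_mul_of_nonneg_right ?_ h2.le
    have hlt : Real.exp (Real.log (quantileB μ ((n : ℝ) / k n)) - 1 / ((n : ℝ) + 1) / Real.sqrt (k n))
        < quantileB μ ((n : ℝ) / k n) := by
      rw [← Real.lt_log_iff_exp_lt h1]
      have : 0 < 1 / ((n : ℝ) + 1) / Real.sqrt (k n) := by positivity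
      linarith
    have h4 := Real.log_lt_log (by positivity) (lt_tailDF_of_lt_quantileB hμ h3 hlt)
    rw [Real.log_inv] at h4
    linarith
  · filter_upwards [hb.eventually_gt_atTop 0, hs.eventually_gt_atTop 0, hr.eventually_gt_atTop 1]
      with n h1 h2 h3
    refine mul_nonpos_of_nonpos_of_nonneg ?_ h2.le
    rw [Real.exp_log h1]
    have h4 := Real.log_le_log (tailDF_pos hF _) (tailDF_quantileB_le (μ := μ) h3)
    rw [Real.log_inv] at h4
    linarith

/-- The expected number of exceedances over `b(n/k) exp(-w/√k)` is `k + α z √k + o(√k)`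
when `w → z`. -/
lemma tendsto_expected_count (hF : ParetoTail μ α l) (hμ : μ (Iio 0) = 0)
    (hk : TailFraction k) {g : ℝ → ℝ} {K γ A : ℝ} (hA2 : CondA2 l g K γ A (quantileB μ) k)
    {w : ℕ → ℝ} {z : ℝ} (hw : Tendsto w atTop (𝓝 z)) :
    Tendsto (fun n : ℕ =>
      ((n : ℝ) / k n * tailDF μ (Real.exp (Real.log (quantileB μ ((n : ℝ) / k n))
          - w n / Real.sqrt (k n))) - 1) * Real.sqrt (k n)) atTop (𝓝 (α * z)) := by
  have hs := tendsto_sqrt_atTop_of_tailFraction hk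
  have hr := tendsto_ratio_atTop_of_tailFraction hk
  have h := (tendsto_log_tailDF_increment hF hk hA2 hw).add
    (tendsto_log_expected_count_at_quantileB hF hμ hk hA2)
  rw [add_zero] at h
  simp only [← add_mul] at h
  set L : ℕ → ℝ := fun n =>
    Real.log (tailDF μ (Real.exp (Real.log (quantileB μ ((n : ℝ) / k n)) - w n / Real.sqrt (k n))))
      - Real.log (tailDF μ (Real.exp (Real.log (quantileB μ ((n : ℝ) / k n)))))
      + (Real.log (tailDF μ (Real.exp (Real.log (quantileB μ ((n : ℝ) / k n)))))
        + Real.log ((n : ℝ) / k n)) with hL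
  have h' : Tendsto (fun n => L n * Real.sqrt (k n)) atTop (𝓝 (α * z)) := h
  have hder : HasDerivAt (fun t => Real.exp t - 1) 1 0 := by
    simpa using (Real.hasDerivAt_exp 0).sub_const 1
  have h0 : Tendsto L atTop (𝓝 0) := (h'.div_atTop hs).congr' (by
    filter_upwards [hs.eventually_gt_atTop 0] with n hn
    exact mul_div_cancel_right₀ _ hn.ne')
  have h2 := tendsto_comp_mul_of_hasDerivAt hder (by simp) h0 h'
  rw [one_mul] at h2
  refine h2.congr' ?_
  filter_upwards [hr.eventually_gt_atTop 0] with n hn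
  congr 2
  simp only [hL]
  rw [← add_assoc, sub_add_cancel, Real.exp_add, Real.exp_log (tailDF_pos hF _), Real.exp_log hn, mul_comm]

end Threshold

lemma abs_integral_sub_integral_le_of_forall_measurableSet {E : Type*} [MeasurableSpace E]
    {P Q : Measure E} [IsProbabilityMeasure P] [IsProbabilityMeasure Q] {β : ℝ}
    (h : ∀ S, MeasurableSet S → |P.real S - Q.real S| ≤ β) {f : E → ℝ} (hf : Measurable f)
    (hf0 : ∀ x, 0 ≤ f x) (hf1 : ∀ x, f x ≤ 1) :
    |(∫ x, f x ∂P) - ∫ x, f x ∂Q| ≤ β := by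
  have hconv : ∀ ν : Measure E, IsProbabilityMeasure ν → Integrable f ν := fun ν _ =>
    Integrable.of_bound hf.aestronglyMeasurable 1 (Eventually.of_forall fun x => by
      rw [Real.norm_eq_abs, abs_of_nonneg (hf0 x)]; exact hf1 x)
  have hrep : ∀ ν : Measure E, IsProbabilityMeasure ν →
      ∫ x, f x ∂ν = ∫ t in Ioc (0 : ℝ) 1, ν.real {x | t ≤ f x} := fun ν _ =>
    (hconv ν inferInstance).integral_eq_integral_Ioc_meas_le
      (Eventually.of_forall hf0) (Eventually.of_forall hf1)
  have hanti : ∀ ν : Measure E, IsProbabilityMeasure ν →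
      IntegrableOn (fun t => ν.real {x | t ≤ f x}) (Ioc (0 : ℝ) 1) := fun ν _ => by
    have : Antitone (fun t => ν.real {x | t ≤ f x}) := fun a b hab =>
      measureReal_mono fun x (hx : b ≤ f x) => hab.trans hx
    exact (this.antitoneOn _ |>.integrableOn_isCompact isCompact_Icc).mono_set Ioc_subset_Icc_self
  rw [hrep P inferInstance, hrep Q inferInstance,
    ← integral_sub (hanti P inferInstance) (hanti Q inferInstance)]
  have := norm_setIntegral_le_of_norm_le_const (μ := volume) (s := Ioc (0 : ℝ) 1) (C := β)
    (f := fun t => P.real {x | t ≤ f x} - Q.real {x | t ≤ f x}) (by simp)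
    (fun t _ => h _ (measurableSet_le measurable_const hf))
  simpa using this

lemma norm_integral_sub_integral_le_of_forall_measurableSet {E : Type*} [MeasurableSpace E]
    {P Q : Measure E} [IsProbabilityMeasure P] [IsProbabilityMeasure Q] {β : ℝ}
    (h : ∀ S, MeasurableSet S → |P.real S - Q.real S| ≤ β) {f : E → ℂ} (hf : Measurable f)
    (hf1 : ∀ x, ‖f x‖ ≤ 1) :
    ‖(∫ x, f x ∂P) - ∫ x, f x ∂Q‖ ≤ 4 * β := by
  have hconv : ∀ ν : Measure E, IsProbabilityMeasure ν → Integrable f ν := fun ν _ =>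
    Integrable.of_bound hf.aestronglyMeasurable 1 (Eventually.of_forall hf1)
  have hreal : ∀ u : E → ℝ, Measurable u → (∀ x, |u x| ≤ 1) →
      |(∫ x, u x ∂P) - ∫ x, u x ∂Q| ≤ 2 * β := by
    intro u hu hu1
    have huint : ∀ ν : Measure E, IsProbabilityMeasure ν → Integrable u ν := fun ν _ =>
      Integrable.of_bound hu.aestronglyMeasurable 1 (Eventually.of_forall hu1)
    have h1 := abs_integral_sub_integral_le_of_forall_measurableSet h
      (f := fun x => (1 + u x) / 2) (by fun_prop)
      (fun x => by have := (abs_le.1 (hu1 x)).1; linarith)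
      (fun x => by have := (abs_le.1 (hu1 x)).2; linarith)
    have h2 : ∀ ν : Measure E, IsProbabilityMeasure ν →
        ∫ x, (1 + u x) / 2 ∂ν = (1 + ∫ x, u x ∂ν) / 2 := by
      intro ν _
      rw [integral_div, integral_add (integrable_const _) (huint ν inferInstance)]
      simp
    rw [h2 P inferInstance, h2 Q inferInstance, ← sub_div, add_sub_add_left_eq_sub, abs_div,
      abs_two] at h1
    linarith
  have hre := hreal (fun x => (f x).re) (Complex.measurable_re.comp hf)
    (fun x => (Complex.abs_re_le_norm _).trans (hf1 x))
  have him := hreal (fun x => (f x).im) (Complex.measurable_im.comp hf)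
    (fun x => (Complex.abs_im_le_norm _).trans (hf1 x))
  have hre' : ∀ ν : Measure E, IsProbabilityMeasure ν →
      ∫ x, (f x).re ∂ν = (∫ x, f x ∂ν).re := fun ν _ => integral_re (hconv ν inferInstance)
  have him' : ∀ ν : Measure E, IsProbabilityMeasure ν →
      ∫ x, (f x).im ∂ν = (∫ x, f x ∂ν).im := fun ν _ => integral_im (hconv ν inferInstance)
  rw [hre' P inferInstance, hre' Q inferInstance, ← Complex.sub_re] at hre
  rw [him' P inferInstance, him' Q inferInstance, ← Complex.sub_im] at him
  exact (Complex.norm_le_abs_re_add_abs_im _).trans (by linarith)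

lemma betaMix_nonneg {X : ℕ → Ω → ℝ} (lag : ℕ) : 0 ≤ betaMix X lag :=
  Real.iSup_nonneg fun _ => Real.iSup_nonneg fun _ => abs_nonneg _

lemma integral_shift_eq {X : ℕ → Ω → ℝ} (hX : ∀ i, Measurable (X i)) (hstat : IsStationary X)
    {E : Type*} [NormedAddCommGroup E] [NormedSpace ℝ E] [MeasurableSpace E] [BorelSpace E]
    [SecondCountableTopology E]
    {H : (ℕ → ℝ) → E} (hH : Measurable H) (j : ℕ) :
    ∫ ω, H (fun i => X (i + j) ω) = ∫ ω, H (fun i => X i ω) := by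
  have h1 : Measurable (fun ω => fun i : ℕ => X (i + j) ω) := measurable_pi_lambda _ fun i => hX _
  have h2 : Measurable (fun ω => fun i : ℕ => X i ω) := measurable_pi_lambda _ fun i => hX _
  rw [← integral_map h1.aemeasurable hH.aestronglyMeasurable,
    ← integral_map h2.aemeasurable hH.aestronglyMeasurable, hstat j]

lemma integral_block_eq {X : ℕ → Ω → ℝ} (hX : ∀ i, Measurable (X i)) (hstat : IsStationary X)
    {E : Type*} [NormedAddCommGroup E] [NormedSpace ℝ E] [MeasurableSpace E] [BorelSpace E]
    [SecondCountableTopology E] {p : ℕ}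
    {G : (Fin p → ℝ) → E} (hG : Measurable G) (s : ℕ) :
    ∫ ω, G (fun i : Fin p => X (s + 1 + i) ω) = ∫ ω, G (fun i : Fin p => X (1 + i) ω) := by
  have h := integral_shift_eq hX hstat (H := fun x => G fun i : Fin p => x (1 + i))
    (hG.comp (measurable_pi_lambda _ fun i => measurable_pi_apply _)) s
  rw [← h]
  simp only [add_comm, add_left_comm]

section Mixing

variable [IsProbabilityMeasure (ℙ : Measure Ω)] {X : ℕ → Ω → ℝ}

lemma abs_joint_sub_prod_le_betaMix (hX : ∀ i, Measurable (X i)) (lag m : ℕ)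
    {S : Set ((Fin m → ℝ) × (ℕ → ℝ))} (hS : MeasurableSet S) :
    |(Measure.map
        (fun ω => ((fun i : Fin m => X ((i : ℕ) + 1) ω, fun i : ℕ => X (m + lag + 1 + i) ω)))
        (ℙ : Measure Ω)).real S
      - ((Measure.map (fun ω => fun i : Fin m => X ((i : ℕ) + 1) ω) (ℙ : Measure Ω)).prod
          (Measure.map (fun ω => fun i : ℕ => X (m + lag + 1 + i) ω) (ℙ : Measure Ω))).real S|
      ≤ betaMix X lag := by
  have hone : ∀ (m : ℕ) (S : Set ((Fin m → ℝ) × (ℕ → ℝ))),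
      |(Measure.map
        (fun ω => ((fun i : Fin m => X ((i : ℕ) + 1) ω, fun i : ℕ => X (m + lag + 1 + i) ω)))
        (ℙ : Measure Ω)).real S
      - ((Measure.map (fun ω => fun i : Fin m => X ((i : ℕ) + 1) ω) (ℙ : Measure Ω)).prod
          (Measure.map (fun ω => fun i : ℕ => X (m + lag + 1 + i) ω) (ℙ : Measure Ω))).real S|
      ≤ 1 := by
    intro m S
    have h1 : Measurable (fun ω => fun i : Fin m => X ((i : ℕ) + 1) ω) :=
      measurable_pi_lambda _ fun i => hX _
    have h2 : Measurable (fun ω => fun i : ℕ => X (m + lag + 1 + i) ω) :=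
      measurable_pi_lambda _ fun i => hX _
    have := Measure.isProbabilityMeasure_map (μ := (ℙ : Measure Ω)) h1.aemeasurable
    have := Measure.isProbabilityMeasure_map (μ := (ℙ : Measure Ω)) h2.aemeasurable
    have := Measure.isProbabilityMeasure_map (μ := (ℙ : Measure Ω)) (h1.prodMk h2).aemeasurable
    exact abs_sub_le_of_nonneg_of_le measureReal_nonneg measureReal_le_one measureReal_nonneg
      measureReal_le_one
  refine le_ciSup_of_le ⟨1, ?_⟩ m (le_ciSup_of_le ⟨1, ?_⟩ ⟨S, hS⟩ le_rfl)
  · rintro _ ⟨m, rfl⟩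
    have : Nonempty (Subtype (MeasurableSet : Set ((Fin m → ℝ) × (ℕ → ℝ)) → Prop)) :=
      ⟨⟨∅, MeasurableSet.empty⟩⟩
    exact ciSup_le fun S => hone m S.1
  · rintro _ ⟨S, rfl⟩
    exact hone m S.1

lemma norm_integral_mul_sub_le_betaMix (hX : ∀ i, Measurable (X i)) (lag m : ℕ)
    {F : (Fin m → ℝ) → ℂ} {G : (ℕ → ℝ) → ℂ} (hF : Measurable F) (hG : Measurable G)
    (hF1 : ∀ x, ‖F x‖ ≤ 1) (hG1 : ∀ x, ‖G x‖ ≤ 1) :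
    ‖(∫ ω, F (fun i => X ((i : ℕ) + 1) ω) * G (fun i => X (m + lag + 1 + i) ω))
      - (∫ ω, F (fun i => X ((i : ℕ) + 1) ω)) * ∫ ω, G (fun i => X (m + lag + 1 + i) ω)‖
      ≤ 4 * betaMix X lag := by
  have h1 : Measurable (fun ω => fun i : Fin m => X ((i : ℕ) + 1) ω) :=
    measurable_pi_lambda _ fun i => hX _
  have h2 : Measurable (fun ω => fun i : ℕ => X (m + lag + 1 + i) ω) :=
    measurable_pi_lambda _ fun i => hX _
  have := Measure.isProbabilityMeasure_map (μ := (ℙ : Measure Ω)) h1.aemeasurable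
  have := Measure.isProbabilityMeasure_map (μ := (ℙ : Measure Ω)) h2.aemeasurable
  have := Measure.isProbabilityMeasure_map (μ := (ℙ : Measure Ω)) (h1.prodMk h2).aemeasurable
  have hFG : Measurable fun z : (Fin m → ℝ) × (ℕ → ℝ) => F z.1 * G z.2 :=
    (hF.comp measurable_fst).mul (hG.comp measurable_snd)
  have h := norm_integral_sub_integral_le_of_forall_measurableSet
    (fun S hS => abs_joint_sub_prod_le_betaMix hX lag m hS)
    hFG
    (fun z => by
      rw [norm_mul]
      exact mul_le_one₀ (hF1 _) (norm_nonneg _) (hG1 _))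
  rw [integral_map (h1.prodMk h2).aemeasurable hFG.aestronglyMeasurable,
    integral_prod_mul, integral_map h1.aemeasurable hF.aestronglyMeasurable,
    integral_map h2.aemeasurable hG.aestronglyMeasurable] at h
  exact h

lemma norm_integral_prod_blocks_sub_pow_le (hX : ∀ i, Measurable (X i)) (hstat : IsStationary X)
    {p : ℕ} {G : (Fin p → ℝ) → ℂ} (hG : Measurable G) (hG1 : ∀ x, ‖G x‖ ≤ 1) (s q M : ℕ) :
    ‖(∫ ω, ∏ j ∈ Finset.range M, G (fun i : Fin p => X (s + j * (p + q) + 1 + i) ω))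
      - (∫ ω, G (fun i : Fin p => X (1 + i) ω)) ^ M‖ ≤ M * (4 * betaMix X q) := by
  set φ := ∫ ω, G (fun i : Fin p => X (1 + i) ω) with hφ
  have hφ1 : ‖φ‖ ≤ 1 := by
    have := norm_integral_le_of_norm_le_const (μ := (ℙ : Measure Ω))
      (f := fun ω => G (fun i : Fin p => X (1 + i) ω)) (C := 1) (Eventually.of_forall fun ω => hG1 _)
    simpa using this
  have hβ : 0 ≤ 4 * betaMix X q := mul_nonneg (by norm_num) (betaMix_nonneg q)
  induction M with
  | zero => simp
  | succ M ih =>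
    have hstep : ‖(∫ ω, ∏ j ∈ Finset.range (M + 1),
          G (fun i : Fin p => X (s + j * (p + q) + 1 + i) ω))
        - (∫ ω, ∏ j ∈ Finset.range M, G (fun i : Fin p => X (s + j * (p + q) + 1 + i) ω)) * φ‖
        ≤ 4 * betaMix X q := by
      simp only [Finset.prod_range_succ]
      rw [hφ, ← integral_block_eq hX hstat hG (s + M * (p + q))]
      rcases M with _ | M
      · simpa using hβ
      · set m := s + M * (p + q) + p with hm
        have hmq : s + (M + 1) * (p + q) = m + q := by rw [hm]; ring
        let ext : (Fin m → ℝ) → ℕ → ℝ := fun v i => if h : i < m then v ⟨i, h⟩ else 0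
        have hext : Measurable ext := by
          refine measurable_pi_lambda _ fun i => ?_
          by_cases h : i < m
          · simp only [ext, h, dite_true]; exact measurable_pi_apply _
          · simp only [ext, h, dite_false]; exact measurable_const
        have h := norm_integral_mul_sub_le_betaMix hX q m
          (F := fun v => ∏ j ∈ Finset.range (M + 1),
            G (fun i : Fin p => ext v (s + j * (p + q) + i)))
          (G := fun x => G (fun i : Fin p => x i))
          (Finset.measurable_prod _ fun j _ => hG.comp
            (measurable_pi_lambda _ fun i => measurable_pi_iff.1 hext _))
          (hG.comp (measurable_pi_lambda _ fun i => measurable_pi_apply _))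
          (fun v => by
            rw [norm_prod]
            exact Finset.prod_le_one (fun _ _ => norm_nonneg _) fun _ _ => hG1 _)
          (fun x => hG1 _)
        rw [hmq]
        have heq : ∀ ω, ∏ j ∈ Finset.range (M + 1), G (fun i : Fin p =>
              ext (fun i => X ((i : ℕ) + 1) ω) (s + j * (p + q) + i))
            = ∏ j ∈ Finset.range (M + 1), G (fun i : Fin p => X (s + j * (p + q) + 1 + i) ω) := by
          intro ω
          refine Finset.prod_congr rfl fun j hj => ?_
          congr 1
          funext i
          have hjM : j ≤ M := Nat.lt_succ_iff.1 (Finset.mem_range.1 hj)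
          have hlt : s + j * (p + q) + i < m := by
            have := Nat.mul_le_mul_right (p + q) hjM
            have := i.2
            omega
          simp only [ext, hlt, dite_true]
          rw [add_right_comm]
        simp only [heq] at h
        exact h
    have hdec : (∫ ω, ∏ j ∈ Finset.range (M + 1),
          G (fun i : Fin p => X (s + j * (p + q) + 1 + i) ω))
        - φ ^ (M + 1)
        = ((∫ ω, ∏ j ∈ Finset.range (M + 1), G (fun i : Fin p => X (s + j * (p + q) + 1 + i) ω))
          - (∫ ω, ∏ j ∈ Finset.range M, G (fun i : Fin p => X (s + j * (p + q) + 1 + i) ω)) * φ)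
        + ((∫ ω, ∏ j ∈ Finset.range M, G (fun i : Fin p => X (s + j * (p + q) + 1 + i) ω))
          - φ ^ M) * φ := by ring
    rw [hdec]
    refine (norm_add_le _ _).trans ?_
    rw [norm_mul]
    have := mul_le_of_le_one_right (norm_nonneg ((∫ ω, ∏ j ∈ Finset.range M,
      G (fun i : Fin p => X (s + j * (p + q) + 1 + i) ω)) - φ ^ M)) hφ1
    push_cast
    linarith

end Mixing

lemma tendsto_pow_exp_of_tendsto_mul_sub_one {ι : Type*} {L : Filter ι} {φ : ι → ℂ} {m : ι → ℕ}
    {c : ℂ} (hφ : Tendsto φ L (𝓝 1)) (hm : Tendsto (fun n => (m n : ℂ) * (φ n - 1)) L (𝓝 c)) :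
    Tendsto (fun n => φ n ^ m n) L (𝓝 (Complex.exp c)) := by
  have hd : HasDerivAt (fun z : ℂ => Complex.log (1 + z)) 1 0 := by
    have h := (Complex.hasDerivAt_log (z := 1 + 0) (by simp)).comp_const_add 1 0
    simpa using h
  have hy : Tendsto (fun n => φ n - 1) L (𝓝 0) := by simpa using hφ.sub_const 1
  have hlog : Tendsto (fun n => Complex.log (1 + (φ n - 1)) * m n) L (𝓝 (1 * c)) :=
    tendsto_comp_mul_of_hasDerivAt hd (by simp) hy (by simpa only [mul_comm] using hm)
  rw [one_mul] at hlog
  refine ((Complex.continuous_exp.tendsto c).comp hlog).congr' ?_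
  filter_upwards [hφ.eventually_ne one_ne_zero] with n hn
  rw [Function.comp_apply, mul_comm, Complex.exp_nat_mul, add_sub_cancel, Complex.exp_log hn]

lemma norm_exp_mul_I_sub_quadratic_le {x : ℝ} (hx : |x| ≤ 1) :
    ‖Complex.exp (x * Complex.I) - 1 - x * Complex.I + (x : ℂ) ^ 2 / 2‖ ≤ |x| * x ^ 2 := by
  have h := Complex.exp_bound (x := x * Complex.I) (by simpa using hx) (n := 3) (by norm_num)
  have hsum : ∑ m ∈ Finset.range 3, ((x : ℂ) * Complex.I) ^ m / (m.factorial : ℂ)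
      = 1 + x * Complex.I - (x : ℂ) ^ 2 / 2 := by
    simp [Finset.sum_range_succ, mul_pow, Nat.factorial]
    ring
  rw [hsum] at h
  have hn : ‖(x : ℂ) * Complex.I‖ = |x| := by simp
  rw [hn] at h
  calc _ = ‖Complex.exp (x * Complex.I) - (1 + x * Complex.I - (x : ℂ) ^ 2 / 2)‖ := by ring_nf
    _ ≤ _ := h
    _ ≤ |x| ^ 3 * 1 := by
        gcongr
        norm_num [Nat.factorial]
    _ = |x| * x ^ 2 := by rw [← sq_abs x]; ring

lemma tendsto_mul_integral_exp_sub_one [IsProbabilityMeasure (ℙ : Measure Ω)]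
    {Y : ℕ → Ω → ℝ} {B w : ℕ → ℝ} {v : ℝ} (hY : ∀ n, Measurable (Y n))
    (hB : ∀ n ω, |Y n ω| ≤ B n) (hB0 : Tendsto B atTop (𝓝 0)) (hY0 : ∀ n, ∫ ω, Y n ω = 0)
    (hw : Tendsto (fun n => w n * ∫ ω, Y n ω ^ 2) atTop (𝓝 v)) (θ : ℝ) :
    Tendsto (fun n => (w n : ℂ) * ((∫ ω, Complex.exp ((θ * Y n ω : ℝ) * Complex.I)) - 1)) atTop
      (𝓝 (-(θ ^ 2 * v / 2) : ℝ)) := by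
  have hint1 : ∀ n, Integrable (Y n) := fun n =>
    Integrable.of_bound (hY n).aestronglyMeasurable (B n) (Eventually.of_forall (hB n))
  have hint2 : ∀ n, Integrable (fun ω => Y n ω ^ 2) := fun n =>
    Integrable.of_bound ((hY n).pow_const 2).aestronglyMeasurable (B n ^ 2)
      (Eventually.of_forall fun ω => by
        rw [norm_pow, Real.norm_eq_abs]
        exact pow_le_pow_left₀ (abs_nonneg _) (hB n ω) 2)
  have hinte : ∀ n, Integrable (fun ω => Complex.exp ((θ * Y n ω : ℝ) * Complex.I)) := fun n =>
    Integrable.of_bound (by have := hY n; fun_prop) 1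
      (Eventually.of_forall fun ω => by rw [Complex.norm_exp_ofReal_mul_I])
  have hθB : Tendsto (fun n => |θ| * B n) atTop (𝓝 0) := by simpa using hB0.const_mul |θ|
  have hkey : ∀ᶠ n in atTop,
      ‖(w n : ℂ) * ((∫ ω, Complex.exp ((θ * Y n ω : ℝ) * Complex.I)) - 1)
        - (-(θ ^ 2 * (w n * ∫ ω, Y n ω ^ 2) / 2) : ℝ)‖
      ≤ |θ| * B n * (θ ^ 2 * |w n * ∫ ω, Y n ω ^ 2|) := by
    filter_upwards [hθB.eventually (ge_mem_nhds one_pos)] with n hn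
    have hexp : ∫ ω, (Complex.exp ((θ * Y n ω : ℝ) * Complex.I) - 1
          - (θ * Y n ω : ℝ) * Complex.I + ((θ * Y n ω : ℝ) : ℂ) ^ 2 / 2)
        = (∫ ω, Complex.exp ((θ * Y n ω : ℝ) * Complex.I)) - 1
          + ((θ ^ 2 * ∫ ω, Y n ω ^ 2 : ℝ) : ℂ) / 2 := by
      have hi1 : Integrable (fun ω => ((θ * Y n ω : ℝ) : ℂ) * Complex.I) :=
        (((hint1 n).const_mul θ).ofReal (𝕜 := ℂ)).mul_const _
      have hi2 : Integrable (fun ω => ((θ * Y n ω : ℝ) : ℂ) ^ 2 / 2) := by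
        have := (((hint2 n).const_mul (θ ^ 2)).ofReal (𝕜 := ℂ)).div_const 2
        refine this.congr (Eventually.of_forall fun ω => ?_)
        simp [mul_pow]
      have hc : Integrable (fun _ : Ω => (1 : ℂ)) := integrable_const _
      have hi3 : Integrable (fun ω => Complex.exp ((θ * Y n ω : ℝ) * Complex.I) - 1) :=
        (hinte n).sub hc
      have hi4 : Integrable (fun ω => Complex.exp ((θ * Y n ω : ℝ) * Complex.I) - 1
          - (θ * Y n ω : ℝ) * Complex.I) := hi3.sub hi1
      rw [integral_add hi4 hi2, integral_sub hi3 hi1, integral_sub (hinte n) hc]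
      have e1 : ∫ ω, ((θ * Y n ω : ℝ) : ℂ) * Complex.I = 0 := by
        rw [integral_mul_const, integral_complex_ofReal, integral_const_mul, hY0]; simp
      have e2 : ∫ ω, ((θ * Y n ω : ℝ) : ℂ) ^ 2 / 2 = ((θ ^ 2 * ∫ ω, Y n ω ^ 2 : ℝ) : ℂ) / 2 := by
        rw [integral_div, ← integral_const_mul, ← integral_complex_ofReal]
        simp [mul_pow]
      rw [e1, e2]
      simp
    have hb : ‖∫ ω, (Complex.exp ((θ * Y n ω : ℝ) * Complex.I) - 1
          - (θ * Y n ω : ℝ) * Complex.I + ((θ * Y n ω : ℝ) : ℂ) ^ 2 / 2)‖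
        ≤ ∫ ω, |θ| * B n * θ ^ 2 * Y n ω ^ 2 := by
      refine norm_integral_le_of_norm_le ((hint2 n).const_mul _) (Eventually.of_forall fun ω => ?_)
      have h1 : |θ * Y n ω| ≤ |θ| * B n := by
        rw [abs_mul]; exact mul_le_mul_of_nonneg_left (hB n ω) (abs_nonneg _)
      refine (norm_exp_mul_I_sub_quadratic_le (h1.trans hn)).trans ?_
      rw [mul_pow, mul_assoc (|θ| * B n)]
      gcongr
    have heq : (w n : ℂ) * ((∫ ω, Complex.exp ((θ * Y n ω : ℝ) * Complex.I)) - 1)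
        - (-(θ ^ 2 * (w n * ∫ ω, Y n ω ^ 2) / 2) : ℝ)
        = w n * ((∫ ω, Complex.exp ((θ * Y n ω : ℝ) * Complex.I)) - 1
          + ((θ ^ 2 * ∫ ω, Y n ω ^ 2 : ℝ) : ℂ) / 2) := by
      push_cast; ring
    rw [heq, ← hexp, norm_mul, Complex.norm_real, Real.norm_eq_abs]
    rw [integral_const_mul] at hb
    refine (mul_le_mul_of_nonneg_left hb (abs_nonneg (w n))).trans (le_of_eq ?_)
    rw [abs_mul, abs_of_nonneg (integral_nonneg fun ω => sq_nonneg (Y n ω))]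
    ring
  have hlim : Tendsto (fun n => ((-(θ ^ 2 * (w n * ∫ ω, Y n ω ^ 2) / 2) : ℝ) : ℂ)) atTop
      (𝓝 (-(θ ^ 2 * v / 2) : ℝ)) :=
    (Complex.continuous_ofReal.tendsto _).comp (((hw.const_mul _).div_const 2).neg)
  have hdiff := squeeze_zero_norm' hkey
    (by simpa using hθB.mul (hw.abs.const_mul (θ ^ 2)))
  simpa using hdiff.add hlim

lemma sum_Icc_sq_eq (a : ℕ → ℝ) (N : ℕ) :
    (∑ i ∈ Finset.Icc 1 N, a i) ^ 2
      = ∑ i ∈ Finset.Icc 1 N, a i ^ 2 + 2 * ∑ p ∈ pairsUpTo N, a p.1 * a p.2 := by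
  induction N with
  | zero => simp [pairsUpTo]
  | succ N ih =>
    have hpairs : pairsUpTo (N + 1)
        = (pairsUpTo N).disjUnion ((Finset.Icc 1 N).map
            (Function.Embedding.sectL ℕ (N + 1))) (by
          rw [Finset.disjoint_left]
          intro p hp hp'
          simp only [pairsUpTo, Finset.mem_filter, Finset.mem_product, Finset.mem_Icc,
            Finset.mem_map, Function.Embedding.sectL_apply] at hp hp'
          obtain ⟨i, -, rfl⟩ := hp'
          omega) := by
      ext ⟨i, j⟩
      simp only [pairsUpTo, Finset.mem_filter, Finset.mem_product, Finset.mem_Icc,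
        Finset.mem_map, Function.Embedding.sectL_apply, Finset.mem_disjUnion, Prod.mk.injEq]
      constructor
      · intro h
        by_cases hj : j = N + 1
        · exact Or.inr ⟨i, by omega, rfl, hj.symm⟩
        · exact Or.inl (by omega)
      · rintro (h | ⟨i', h, rfl, rfl⟩) <;> omega
    rw [hpairs, Finset.sum_disjUnion, Finset.sum_map, Finset.sum_Icc_succ_top (by omega),
      Finset.sum_Icc_succ_top (by omega), add_sq, ih]
    simp only [Function.Embedding.sectL_apply, ← Finset.sum_mul]
    ring

lemma sum_range_mul_eq (f : ℕ → ℝ) (p q m : ℕ) :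
    ∑ i ∈ Finset.range (m * (p + q)), f i
      = ∑ j ∈ Finset.range m, ∑ i ∈ Finset.range p, f (j * (p + q) + i)
        + ∑ j ∈ Finset.range m, ∑ i ∈ Finset.range q, f (p + j * (p + q) + i) := by
  induction m with
  | zero => simp
  | succ m ih =>
    rw [add_mul, one_mul, Finset.sum_range_add, Finset.sum_range_add, ih, Finset.sum_range_succ,
      Finset.sum_range_succ]
    simp only [add_comm p, add_assoc]
    ring

/-- The exceedance indicator `1{x > u}` centred at `c`. -/
def exceedDev (u c x : ℝ) : ℝ := (if u < x then 1 else 0) - c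

/-- The sum of the centred exceedance indicators of `X_{s+1}, …, X_{s+p}`. -/
def devSum (X : ℕ → Ω → ℝ) (u c : ℝ) (s p : ℕ) (ω : Ω) : ℝ :=
  ∑ i ∈ Finset.range p, exceedDev u c (X (s + 1 + i) ω)

lemma measurable_exceedDev (u c : ℝ) : Measurable (exceedDev u c) :=
  (Measurable.ite measurableSet_Ioi measurable_const measurable_const).sub_const c

lemma measurable_devSum {X : ℕ → Ω → ℝ} (hX : ∀ i, Measurable (X i)) (u c : ℝ) (s p : ℕ) :
    Measurable (devSum X u c s p) :=
  Finset.measurable_sum _ fun _ _ => (measurable_exceedDev u c).comp (hX _)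

lemma abs_exceedDev_le {u c : ℝ} (hc0 : 0 ≤ c) (hc1 : c ≤ 1) (x : ℝ) : |exceedDev u c x| ≤ 1 := by
  unfold exceedDev
  split_ifs <;> rw [abs_le] <;> constructor <;> linarith

lemma abs_devSum_le {Ω : Type*} {X : ℕ → Ω → ℝ} {u c : ℝ} (hc0 : 0 ≤ c) (hc1 : c ≤ 1) (s p : ℕ) (ω : Ω) :
    |devSum X u c s p ω| ≤ p := by
  refine (Finset.abs_sum_le_sum_abs _ _).trans ?_
  refine (Finset.sum_le_sum fun i _ => abs_exceedDev_le hc0 hc1 _).trans ?_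
  simp

lemma devSum_zero_eq_sum_Icc {Ω : Type*} (X : ℕ → Ω → ℝ) (u c : ℝ) (p : ℕ) (ω : Ω) :
    devSum X u c 0 p ω = ∑ i ∈ Finset.Icc 1 p, exceedDev u c (X i ω) := by
  rw [devSum, ← Finset.Ico_add_one_right_eq_Icc, Finset.sum_Ico_eq_sum_range]
  simp

lemma tailDF_nonneg (μ : Measure ℝ) (u : ℝ) : 0 ≤ tailDF μ u := ENNReal.toReal_nonneg

lemma measurable_exceed {X : ℕ → Ω → ℝ} (hX : ∀ i, Measurable (X i)) (i : ℕ) (u : ℝ) :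
    Measurable fun ω => if u < X i ω then (1 : ℝ) else 0 :=
  Measurable.ite (measurableSet_lt measurable_const (hX i)) measurable_const measurable_const

lemma integral_exceed {X : ℕ → Ω → ℝ} (hX : ∀ i, Measurable (X i)) (hstat : IsStationary X) (i : ℕ) (u : ℝ) :
    ∫ ω, (if u < X i ω then (1 : ℝ) else 0) = tailDF (Measure.map (X 1) (ℙ : Measure Ω)) u := by
  have hH : Measurable fun x : ℕ → ℝ => if u < x 0 then (1 : ℝ) else 0 :=
    Measurable.ite (measurableSet_lt measurable_const (measurable_pi_apply 0)) measurable_const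
      measurable_const
  have hi := integral_shift_eq hX hstat hH i
  have h1 := integral_shift_eq hX hstat hH 1
  simp only [zero_add] at hi h1
  rw [hi, ← h1, tailDF, Measure.map_apply (hX 1) measurableSet_Ioi]
  have : (fun ω => if u < X 1 ω then (1 : ℝ) else 0) = (X 1 ⁻¹' Ioi u).indicator 1 := by
    ext ω; simp [indicator]
  rw [this, integral_indicator_one (hX 1 measurableSet_Ioi)]
  rfl

section Blocks

variable [IsProbabilityMeasure (ℙ : Measure Ω)] {X : ℕ → Ω → ℝ}

lemma integrable_of_measurable_of_abs_le {f : Ω → ℝ} {C : ℝ} (hf : Measurable f)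
    (h : ∀ ω, |f ω| ≤ C) : Integrable f :=
  Integrable.of_bound hf.aestronglyMeasurable C (Eventually.of_forall h)

lemma integrable_exceed (hX : ∀ i, Measurable (X i)) (i : ℕ) (u : ℝ) :
    Integrable fun ω => if u < X i ω then (1 : ℝ) else 0 :=
  integrable_of_measurable_of_abs_le (C := 1) (measurable_exceed hX i u) fun ω => by
    split_ifs <;> simp

lemma tailDF_le_one (hX : ∀ i, Measurable (X i)) (u : ℝ) :
    tailDF (Measure.map (X 1) (ℙ : Measure Ω)) u ≤ 1 := by
  have := Measure.isProbabilityMeasure_map (μ := (ℙ : Measure Ω)) (hX 1).aemeasurable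
  exact measureReal_le_one

lemma integral_devSum (hX : ∀ i, Measurable (X i)) (hstat : IsStationary X) (u : ℝ) (s p : ℕ) :
    ∫ ω, devSum X u (tailDF (Measure.map (X 1) (ℙ : Measure Ω)) u) s p ω = 0 := by
  unfold devSum exceedDev
  have hi : ∀ i, Integrable fun ω => (if u < X i ω then (1 : ℝ) else 0)
      - tailDF (Measure.map (X 1) (ℙ : Measure Ω)) u := fun i =>
    (integrable_exceed hX i u).sub (integrable_const _)
  rw [integral_finsetSum _ fun i _ => hi _]
  refine Finset.sum_eq_zero fun i _ => ?_
  rw [integral_sub (integrable_exceed hX _ u) (integrable_const _), integral_exceed hX hstat]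
  simp

lemma integral_devSum_sq (hX : ∀ i, Measurable (X i)) (hstat : IsStationary X) (u : ℝ) (p : ℕ) :
    ∫ ω, devSum X u (tailDF (Measure.map (X 1) (ℙ : Measure Ω)) u) 0 p ω ^ 2
      = p * (tailDF (Measure.map (X 1) (ℙ : Measure Ω)) u
          * (1 - tailDF (Measure.map (X 1) (ℙ : Measure Ω)) u))
        + 2 * ∑ q ∈ pairsUpTo p, cov (fun ω => if u < X q.1 ω then (1 : ℝ) else 0)
            (fun ω => if u < X q.2 ω then (1 : ℝ) else 0) := by
  set c := tailDF (Measure.map (X 1) (ℙ : Measure Ω)) u with hc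
  have hm : ∀ i, Measurable fun ω => exceedDev u c (X i ω) := fun i =>
    (measurable_exceedDev u c).comp (hX i)
  have hle : ∀ i ω, |exceedDev u c (X i ω)| ≤ 1 := fun i ω =>
    abs_exceedDev_le (tailDF_nonneg _ _) (tailDF_le_one hX u) _
  have hi : ∀ i j, Integrable fun ω => exceedDev u c (X i ω) * exceedDev u c (X j ω) := fun i j =>
    integrable_of_measurable_of_abs_le (C := 1) ((hm i).mul (hm j)) fun ω => by
      rw [abs_mul]; exact mul_le_one₀ (hle _ _) (abs_nonneg _) (hle _ _)
  have hsq : ∀ i, ∫ ω, exceedDev u c (X i ω) ^ 2 = c * (1 - c) := by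
    intro i
    have h : ∀ ω, exceedDev u c (X i ω) ^ 2
        = (1 - 2 * c) * (if u < X i ω then (1 : ℝ) else 0) + c ^ 2 := by
      intro ω
      unfold exceedDev
      split_ifs <;> ring
    simp only [h]
    rw [integral_add ((integrable_exceed hX i u).const_mul _) (integrable_const _),
      integral_const_mul, integral_exceed hX hstat, ← hc]
    simp
    ring
  simp only [devSum_zero_eq_sum_Icc, sum_Icc_sq_eq]
  rw [integral_add, integral_finsetSum, integral_const_mul, integral_finsetSum]
  · simp only [hsq]
    congr 1
    · simp
    · congr 1
      refine Finset.sum_congr rfl fun q _ => ?_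
      unfold cov exceedDev
      simp only [integral_exceed hX hstat, ← hc]
  · exact fun q _ => hi _ _
  · exact fun i _ => by simpa only [sq] using hi i i
  · exact integrable_finsetSum _ fun i _ => by simpa only [sq] using hi i i
  · exact (integrable_finsetSum _ fun i _ => hi _ _).const_mul _

lemma integral_devSum_sub_devSum_sq_le (hX : ∀ i, Measurable (X i)) (hstat : IsStationary X)
    (u b : ℝ) (p : ℕ) :
    ∫ ω, (devSum X u (tailDF (Measure.map (X 1) (ℙ : Measure Ω)) u) 0 p ω
        - devSum X b (tailDF (Measure.map (X 1) (ℙ : Measure Ω)) b) 0 p ω) ^ 2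
      ≤ p ^ 2 * |tailDF (Measure.map (X 1) (ℙ : Measure Ω)) u
          - tailDF (Measure.map (X 1) (ℙ : Measure Ω)) b| := by
  set cu := tailDF (Measure.map (X 1) (ℙ : Measure Ω)) u with hcu
  set cb := tailDF (Measure.map (X 1) (ℙ : Measure Ω)) b with hcb
  let D : ℕ → Ω → ℝ := fun i ω => (if u < X i ω then 1 else 0) - (if b < X i ω then 1 else 0)
  have hDm : ∀ i, Measurable (D i) := fun i => (measurable_exceed hX i u).sub (measurable_exceed hX i b)
  have hD1 : ∀ i ω, |D i ω| ≤ 1 := fun i ω => by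
    simp only [D]; split_ifs <;> simp
  have hDi : ∀ i, ∫ ω, D i ω = cu - cb := fun i => by
    simp only [D]
    rw [integral_sub (integrable_exceed hX i u) (integrable_exceed hX i b),
      integral_exceed hX hstat, integral_exceed hX hstat]
  have hsq : ∀ i ω, D i ω ^ 2 = |D i ω| := fun i ω => by
    simp only [D]; split_ifs <;> simp
  have habs : ∀ i, ∫ ω, |D i ω| = |cu - cb| := by
    intro i
    rcases le_total u b with hub | hub
    · have h : ∀ ω, 0 ≤ D i ω := fun ω => by
        simp only [D]
        split_ifs with h1 h2 h2 <;> norm_num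
        exact h1 (hub.trans_lt h2)
      rw [← hDi i, abs_of_nonneg (integral_nonneg h)]
      exact integral_congr_ae (Eventually.of_forall fun ω => abs_of_nonneg (h ω))
    · have h : ∀ ω, D i ω ≤ 0 := fun ω => by
        simp only [D]
        split_ifs with h1 h2 h2 <;> norm_num
        exact h2 (hub.trans_lt h1)
      rw [← hDi i, abs_of_nonpos (integral_nonpos h), ← integral_neg]
      exact integral_congr_ae (Eventually.of_forall fun ω => abs_of_nonpos (h ω))
  let T : Ω → ℝ := fun ω => ∑ i ∈ Finset.range p, D (0 + 1 + i) ω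
  have hTm : Measurable T := Finset.measurable_sum _ fun _ _ => hDm _
  have hTle : ∀ ω, T ω ^ 2 ≤ p * ∑ i ∈ Finset.range p, |D (0 + 1 + i) ω| := fun ω => by
    have := sq_sum_le_card_mul_sum_sq (s := Finset.range p) (f := fun i => D (0 + 1 + i) ω)
    simpa only [hsq, Finset.card_range] using this
  have hTp : ∀ ω, |T ω| ≤ p := fun ω =>
    (Finset.abs_sum_le_sum_abs _ _).trans
      ((Finset.sum_le_sum fun i _ => hD1 _ ω).trans (by simp))
  have hTi : Integrable T := integrable_of_measurable_of_abs_le hTm hTp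
  have hT2i : Integrable (fun ω => T ω ^ 2) :=
    integrable_of_measurable_of_abs_le (C := (p : ℝ) ^ 2) (hTm.pow_const 2) fun ω => by
      rw [abs_pow]; exact pow_le_pow_left₀ (abs_nonneg _) (hTp ω) 2
  have hDint : ∀ i, Integrable (fun ω => |D i ω|) := fun i =>
    integrable_of_measurable_of_abs_le (C := 1) (hDm i).abs fun ω => by
      rw [abs_abs]; exact hD1 i ω
  have hT1 : ∫ ω, T ω = p * (cu - cb) := by
    simp only [T]
    rw [integral_finsetSum _ fun i _ =>
      integrable_of_measurable_of_abs_le (hDm (0 + 1 + i)) (hD1 (0 + 1 + i))]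
    simp only [hDi, Finset.sum_const, Finset.card_range, nsmul_eq_mul]
  have hT2 : ∫ ω, T ω ^ 2 ≤ p ^ 2 * |cu - cb| := by
    refine (integral_mono hT2i ((integrable_finsetSum _ fun i _ => hDint _).const_mul _)
      hTle).trans (le_of_eq ?_)
    rw [integral_const_mul, integral_finsetSum _ fun i _ => hDint _]
    simp only [habs, Finset.sum_const, Finset.card_range, nsmul_eq_mul]
    ring
  have heq : ∀ ω, (devSum X u cu 0 p ω - devSum X b cb 0 p ω) ^ 2
      = T ω ^ 2 - 2 * (p * (cu - cb)) * T ω + (p * (cu - cb)) ^ 2 := by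
    intro ω
    have : devSum X u cu 0 p ω - devSum X b cb 0 p ω = T ω - p * (cu - cb) := by
      simp only [devSum, exceedDev, T, D, Finset.sum_sub_distrib, Finset.sum_const,
        Finset.card_range, nsmul_eq_mul]
      ring
    rw [this]; ring
  simp only [heq]
  have hi : Integrable fun ω => T ω ^ 2 - 2 * (p * (cu - cb)) * T ω := hT2i.sub (hTi.const_mul _)
  rw [integral_add hi (integrable_const _),
    integral_sub hT2i (hTi.const_mul _), integral_const_mul, hT1]
  simp only [integral_const, probReal_univ, one_smul]
  nlinarith [sq_nonneg ((p : ℝ) * (cu - cb))]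

lemma tendsto_mul_integral_sq_of_sub {A B : ℕ → Ω → ℝ} {C : ℕ → ℝ} {w : ℕ → ℝ} {v : ℝ}
    (hw : ∀ n, 0 ≤ w n) (hA : ∀ n, Measurable (A n)) (hB : ∀ n, Measurable (B n))
    (hAC : ∀ n ω, |A n ω| ≤ C n) (hBC : ∀ n ω, |B n ω| ≤ C n)
    (hlim : Tendsto (fun n => w n * ∫ ω, A n ω ^ 2) atTop (𝓝 v))
    (hdiff : Tendsto (fun n => w n * ∫ ω, (B n ω - A n ω) ^ 2) atTop (𝓝 0)) :
    Tendsto (fun n => w n * ∫ ω, B n ω ^ 2) atTop (𝓝 v) := by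
  have hA2 : ∀ n, Integrable (fun ω => A n ω ^ 2) := fun n =>
    integrable_of_measurable_of_abs_le (C := C n ^ 2) ((hA n).pow_const 2) fun ω => by
      rw [abs_pow]; exact pow_le_pow_left₀ (abs_nonneg _) (hAC n ω) 2
  have hB2 : ∀ n, Integrable (fun ω => B n ω ^ 2) := fun n =>
    integrable_of_measurable_of_abs_le (C := C n ^ 2) ((hB n).pow_const 2) fun ω => by
      rw [abs_pow]; exact pow_le_pow_left₀ (abs_nonneg _) (hBC n ω) 2
  have hD2 : ∀ n, Integrable (fun ω => (B n ω - A n ω) ^ 2) := fun n =>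
    integrable_of_measurable_of_abs_le (C := (C n + C n) ^ 2) (((hB n).sub (hA n)).pow_const 2)
      fun ω => by
        rw [abs_pow]
        exact pow_le_pow_left₀ (abs_nonneg _)
          ((abs_sub _ _).trans (add_le_add (hBC n ω) (hAC n ω))) 2
  have hkey : ∀ η > 0, ∀ n, |w n * (∫ ω, B n ω ^ 2) - w n * ∫ ω, A n ω ^ 2|
      ≤ η * (w n * ∫ ω, A n ω ^ 2) + (1 + η⁻¹) * (w n * ∫ ω, (B n ω - A n ω) ^ 2) := by
    intro η hη n
    have hpt : ∀ ω, |B n ω ^ 2 - A n ω ^ 2|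
        ≤ η * A n ω ^ 2 + (1 + η⁻¹) * (B n ω - A n ω) ^ 2 := by
      intro ω
      set x := A n ω
      set y := B n ω - x with hy
      have hB' : B n ω = x + y := by rw [hy]; ring
      have h1 : 2 * |x * y| ≤ η * x ^ 2 + η⁻¹ * y ^ 2 := by
        have h := sq_nonneg (η * |x| - |y|)
        have h' : η * (2 * |x * y|) ≤ η * (η * x ^ 2 + η⁻¹ * y ^ 2) := by
          rw [mul_add, ← mul_assoc η η⁻¹, mul_inv_cancel₀ hη.ne', abs_mul, ← sq_abs x, ← sq_abs y]
          nlinarith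
        exact le_of_mul_le_mul_left h' hη
      rw [hB']
      have h2 : (x + y) ^ 2 - x ^ 2 = 2 * (x * y) + y ^ 2 := by ring
      rw [h2]
      refine (abs_add_le _ _).trans ?_
      rw [abs_mul, abs_two, abs_of_nonneg (sq_nonneg y)]
      linarith
    have hconv : |(∫ ω, B n ω ^ 2) - ∫ ω, A n ω ^ 2|
        ≤ η * (∫ ω, A n ω ^ 2) + (1 + η⁻¹) * ∫ ω, (B n ω - A n ω) ^ 2 := by
      rw [← integral_sub (hB2 n) (hA2 n), ← integral_const_mul, ← integral_const_mul,
        ← integral_add ((hA2 n).const_mul _) ((hD2 n).const_mul _)]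
      exact abs_integral_le_integral_abs.trans (integral_mono ((hB2 n).sub (hA2 n)).abs
        (((hA2 n).const_mul _).add ((hD2 n).const_mul _)) hpt)
    rw [← mul_sub, abs_mul, abs_of_nonneg (hw n)]
    refine (mul_le_mul_of_nonneg_left hconv (hw n)).trans (le_of_eq ?_)
    ring
  have hv : 0 ≤ v := ge_of_tendsto' hlim fun n =>
    mul_nonneg (hw n) (integral_nonneg fun ω => sq_nonneg _)
  have hzero : Tendsto (fun n => w n * (∫ ω, B n ω ^ 2) - w n * ∫ ω, A n ω ^ 2) atTop (𝓝 0) := by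
    rw [Metric.tendsto_nhds]
    intro ε hε
    set η := ε / (2 * (v + 1)) with hη
    have hη0 : 0 < η := by positivity
    have hb : Tendsto (fun n => η * (w n * ∫ ω, A n ω ^ 2)
        + (1 + η⁻¹) * (w n * ∫ ω, (B n ω - A n ω) ^ 2)) atTop (𝓝 (η * v + (1 + η⁻¹) * 0)) :=
      (hlim.const_mul _).add (hdiff.const_mul _)
    have hlt : η * v + (1 + η⁻¹) * 0 < ε := by
      rw [mul_zero, add_zero, hη, div_mul_eq_mul_div, div_lt_iff₀ (by positivity)]
      nlinarith
    filter_upwards [hb.eventually (gt_mem_nhds hlt)] with n hn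
    rw [Real.dist_eq, sub_zero]
    exact (hkey η hη0 n).trans_lt hn
  simpa using hzero.add hlim

end Blocks

lemma tendsto_floor_mul_div {r : ℕ → ℕ} (hr : Tendsto (fun n => (r n : ℝ)) atTop atTop) {a : ℝ}
    (ha : 0 < a) : Tendsto (fun n => (⌊a * r n⌋₊ : ℝ) / r n) atTop (𝓝 a) :=
  (tendsto_nat_floor_mul_div_atTop ha.le).comp hr

lemma eventually_floor_mul_pos {r : ℕ → ℕ} (hr : Tendsto (fun n => (r n : ℝ)) atTop atTop) {a : ℝ}
    (ha : 0 < a) : ∀ᶠ n in atTop, 0 < ⌊a * r n⌋₊ := by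
  filter_upwards [(hr.const_mul_atTop ha).eventually_ge_atTop 1] with n hn
  exact Nat.floor_pos.2 hn

lemma tendsto_block_count_mul_div {r : ℕ → ℕ} (hr : Tendsto (fun n => (r n : ℝ)) atTop atTop)
    (hrn : Tendsto (fun n => (r n : ℝ) / n) atTop (𝓝 0)) {a c : ℝ} (ha : 0 < a) (hc : 0 < c) :
    Tendsto (fun n => ((n / (⌊a * r n⌋₊ + ⌊c * r n⌋₊) : ℕ) : ℝ) * (r n / n)) atTop
      (𝓝 (a + c)⁻¹) := by
  set L : ℕ → ℕ := fun n => ⌊a * r n⌋₊ + ⌊c * r n⌋₊ with hL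
  have hLr : Tendsto (fun n => (L n : ℝ) / r n) atTop (𝓝 (a + c)) := by
    refine ((tendsto_floor_mul_div hr ha).add (tendsto_floor_mul_div hr hc)).congr fun n => ?_
    simp only [hL]; push_cast; ring
  have hLn : Tendsto (fun n => (L n : ℝ) / n) atTop (𝓝 0) := by
    have h := hLr.mul hrn
    rw [mul_zero] at h
    refine h.congr' ?_
    filter_upwards [hr.eventually_gt_atTop 0] with n hn
    field_simp
  have hpos : ∀ᶠ n : ℕ in atTop, 0 < (L n : ℝ) / n := by
    filter_upwards [eventually_floor_mul_pos hr ha, eventually_gt_atTop 0] with n hn hn0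
    have : 0 < L n := by simp only [hL]; omega
    positivity
  have hinf : Tendsto (fun n : ℕ => (n : ℝ) / L n) atTop atTop := by
    refine (tendsto_inv_nhdsGT_zero.comp
      (tendsto_nhdsWithin_iff.2 ⟨hLn, hpos⟩)).congr fun n => ?_
    simp
  have h1 := (tendsto_nat_floor_div_atTop (R := ℝ)).comp hinf
  have h2 := h1.mul (hLr.inv₀ (add_pos ha hc).ne')
  rw [one_mul] at h2
  refine h2.congr' ?_
  filter_upwards [hpos, eventually_gt_atTop 0, hr.eventually_gt_atTop 0] with n hn hn0 hrn0
  have hn0' : (0 : ℝ) < n := by exact_mod_cast hn0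
  have hLpos : (0 : ℝ) < L n := by
    by_contra hcon
    have := div_nonpos_of_nonpos_of_nonneg (not_lt.1 hcon) hn0'.le
    linarith
  simp only [Function.comp_apply, Nat.floor_div_eq_div]
  change _ = ((n / L n : ℕ) : ℝ) * _
  field_simp

lemma tendsto_div_sqrt_zero {r k : ℕ → ℕ}
    (hrk : Tendsto (fun n => ((r n : ℝ) ^ 2 / k n)) atTop (𝓝 0)) :
    Tendsto (fun n => (r n : ℝ) / Real.sqrt (k n)) atTop (𝓝 0) := by
  have h := (Real.continuous_sqrt.tendsto 0).comp hrk
  rw [Real.sqrt_zero] at h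
  refine h.congr fun n => ?_
  rw [Function.comp_apply, Real.sqrt_div (sq_nonneg _), Real.sqrt_sq (Nat.cast_nonneg _)]

lemma floor_mul_le {a : ℝ} (ha1 : a < 1) (N : ℕ) : ⌊a * N⌋₊ ≤ N := by
  refine Nat.floor_le_of_le ?_
  nlinarith [Nat.cast_nonneg (α := ℝ) N]

lemma tendsto_charFun_blocks [IsProbabilityMeasure (ℙ : Measure Ω)] {X : ℕ → Ω → ℝ}
    (hX : ∀ i, Measurable (X i)) (hstat : IsStationary X) {k r : ℕ → ℕ} {u : ℕ → ℝ} {v : ℝ}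
    (hr : Tendsto (fun n => (r n : ℝ)) atTop atTop)
    (hrn : Tendsto (fun n => (r n : ℝ) / n) atTop (𝓝 0))
    (hrk : Tendsto (fun n => ((r n : ℝ) ^ 2 / k n)) atTop (𝓝 0))
    (hβ : ∀ ε : ℝ, 0 < ε →
      Tendsto (fun n : ℕ => ((n : ℝ) / r n) * betaMix X ⌊ε * r n⌋₊) atTop (𝓝 0))
    (hvar : ∀ a : ℝ, 0 < a → a < 1 → Tendsto (fun n : ℕ => (n : ℝ) / (⌊a * r n⌋₊ * k n)
      * ∫ ω, devSum X (u n) (tailDF (Measure.map (X 1) (ℙ : Measure Ω)) (u n)) 0 ⌊a * r n⌋₊ ω ^ 2)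
      atTop (𝓝 v))
    {a c : ℝ} (ha : 0 < a) (ha1 : a < 1) (hc : 0 < c) (s : ℕ → ℕ) (θ : ℝ) :
    Tendsto (fun n : ℕ => ∫ ω, Complex.exp ((θ * ((∑ j ∈ Finset.range
        (n / (⌊a * r n⌋₊ + ⌊c * r n⌋₊)),
        devSum X (u n) (tailDF (Measure.map (X 1) (ℙ : Measure Ω)) (u n))
          (s n + j * (⌊a * r n⌋₊ + ⌊c * r n⌋₊)) ⌊a * r n⌋₊ ω) / Real.sqrt (k n)) : ℝ) * Complex.I))
      atTop (𝓝 (Real.exp (-(θ ^ 2 * v / 2) * (a * (a + c)⁻¹)) : ℝ)) := by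
  set p : ℕ → ℕ := fun n => ⌊a * r n⌋₊ with hp
  set q : ℕ → ℕ := fun n => ⌊c * r n⌋₊ with hq
  set F : ℕ → ℝ := fun n => tailDF (Measure.map (X 1) (ℙ : Measure Ω)) (u n) with hF
  set m : ℕ → ℕ := fun n => n / (p n + q n) with hm
  have hF0 : ∀ n, 0 ≤ F n := fun n => tailDF_nonneg _ _
  have hF1 : ∀ n, F n ≤ 1 := fun n => tailDF_le_one hX _
  have hmr : Tendsto (fun n => (m n : ℝ) * (r n / n)) atTop (𝓝 (a + c)⁻¹) :=
    tendsto_block_count_mul_div hr hrn ha hc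
  have hpr : Tendsto (fun n => (p n : ℝ) / r n) atTop (𝓝 a) := tendsto_floor_mul_div hr ha
  let φ : ℕ → ℂ := fun n =>
    ∫ ω, Complex.exp ((θ * (devSum X (u n) (F n) 0 (p n) ω / Real.sqrt (k n)) : ℝ) * Complex.I)
  have hφw : Tendsto (fun n : ℕ => (((n : ℝ) / p n : ℝ) : ℂ) * (φ n - 1)) atTop
      (𝓝 (-(θ ^ 2 * v / 2) : ℝ)) := by
    refine tendsto_mul_integral_exp_sub_one (B := fun n => p n / Real.sqrt (k n))
      (fun n => (measurable_devSum hX _ _ _ _).div_const _) (fun n ω => ?_) ?_ (fun n => ?_) ?_ θ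
    · rw [abs_div, abs_of_nonneg (Real.sqrt_nonneg _)]
      exact div_le_div_of_nonneg_right (abs_devSum_le (hF0 n) (hF1 n) _ _ _) (Real.sqrt_nonneg _)
    · refine squeeze_zero (fun n => by positivity) (fun n => ?_) (tendsto_div_sqrt_zero hrk)
      exact div_le_div_of_nonneg_right (Nat.cast_le.2 (floor_mul_le ha1 _)) (Real.sqrt_nonneg _)
    · rw [integral_div, integral_devSum hX hstat, zero_div]
    · refine (hvar a ha ha1).congr fun n => ?_
      simp only [div_pow, Real.sq_sqrt (Nat.cast_nonneg (α := ℝ) (k n))]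
      rw [integral_div]
      ring
  have hpn : Tendsto (fun n : ℕ => (p n : ℝ) / n) atTop (𝓝 0) := by
    refine squeeze_zero (fun n => by positivity) (fun n => ?_) hrn
    exact div_le_div_of_nonneg_right (Nat.cast_le.2 (floor_mul_le ha1 _)) (Nat.cast_nonneg _)
  have hne : ∀ᶠ n : ℕ in atTop, (n : ℝ) ≠ 0 ∧ (p n : ℝ) ≠ 0 ∧ (r n : ℝ) ≠ 0 := by
    filter_upwards [eventually_gt_atTop 0, eventually_floor_mul_pos hr ha,
      hr.eventually_gt_atTop 0] with n h1 h2 h3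
    exact ⟨by exact_mod_cast h1.ne', by exact_mod_cast h2.ne', h3.ne'⟩
  have hφ1 : Tendsto φ atTop (𝓝 1) := by
    have h := ((Complex.continuous_ofReal.tendsto _).comp hpn).mul hφw
    rw [Complex.ofReal_zero, zero_mul] at h
    have h' : Tendsto (fun n => φ n - 1) atTop (𝓝 0) := by
      refine h.congr' ?_
      filter_upwards [hne] with n ⟨h1, h2, _⟩
      rw [Function.comp_apply, ← mul_assoc, ← Complex.ofReal_mul, div_mul_div_cancel₀ h1,
        div_self h2, Complex.ofReal_one, one_mul]
    simpa using h'.add_const 1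
  have hmφ : Tendsto (fun n => (m n : ℂ) * (φ n - 1)) atTop
      (𝓝 ((-(θ ^ 2 * v / 2) * (a * (a + c)⁻¹) : ℝ) : ℂ)) := by
    have h := hφw.mul ((Complex.continuous_ofReal.tendsto (a * (a + c)⁻¹)).comp (hpr.mul hmr))
    rw [← Complex.ofReal_mul] at h
    refine h.congr' ?_
    filter_upwards [hne] with n ⟨h1, h2, h3⟩
    have h2' : (p n : ℂ) ≠ 0 := by exact_mod_cast h2
    have h3' : (r n : ℂ) ≠ 0 := by exact_mod_cast h3
    have h1' : (n : ℂ) ≠ 0 := by exact_mod_cast h1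
    simp only [Function.comp_apply]
    push_cast
    field_simp
  have hpow := tendsto_pow_exp_of_tendsto_mul_sub_one hφ1 hmφ
  let G : (n : ℕ) → (Fin (p n) → ℝ) → ℂ := fun n x =>
    Complex.exp ((θ * ((∑ i, exceedDev (u n) (F n) (x i)) / Real.sqrt (k n)) : ℝ) * Complex.I)
  have hGm : ∀ n, Measurable (G n) := fun n => by
    have : Measurable fun x : Fin (p n) → ℝ => ∑ i, exceedDev (u n) (F n) (x i) :=
      Finset.measurable_sum _ fun i _ => (measurable_exceedDev _ _).comp (measurable_pi_apply i)
    fun_prop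
  have hG1 : ∀ n x, ‖G n x‖ ≤ 1 := fun n x => by rw [Complex.norm_exp_ofReal_mul_I]
  have hGdev : ∀ n t ω, G n (fun i => X (t + 1 + i) ω)
      = Complex.exp ((θ * (devSum X (u n) (F n) t (p n) ω / Real.sqrt (k n)) : ℝ) * Complex.I) := by
    intro n t ω
    simp only [G, devSum]
    rw [Fin.sum_univ_eq_sum_range fun i => exceedDev (u n) (F n) (X (t + 1 + i) ω)]
  have hblock : ∀ n, ‖(∫ ω, Complex.exp ((θ * ((∑ j ∈ Finset.range (m n),
        devSum X (u n) (F n) (s n + j * (p n + q n)) (p n) ω) / Real.sqrt (k n)) : ℝ) * Complex.I))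
      - φ n ^ m n‖ ≤ m n * (4 * betaMix X (q n)) := by
    intro n
    have h := norm_integral_prod_blocks_sub_pow_le hX hstat (hGm n) (hG1 n) (s n) (q n) (m n)
    have h1 : ∫ ω, G n (fun i => X (1 + i) ω) = φ n := by
      have := hGdev n 0
      simp only [zero_add] at this
      simp only [this, φ]
    rw [h1] at h
    simp only [hGdev] at h
    convert h using 4
    funext ω
    rw [← Complex.exp_sum, ← Finset.sum_mul, Finset.sum_div, Finset.mul_sum]
    push_cast
    rfl
  have hsmall : Tendsto (fun n => (m n : ℝ) * (4 * betaMix X (q n))) atTop (𝓝 0) := by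
    have h := (hmr.mul (hβ c hc)).const_mul 4
    rw [mul_zero, mul_zero] at h
    refine h.congr' ?_
    filter_upwards [hne] with n ⟨h1, _, h3⟩
    simp only [hq]
    field_simp
  have hdiff := squeeze_zero_norm hblock hsmall
  rw [Complex.ofReal_exp]
  simpa using hdiff.add hpow

lemma norm_exp_add_add_sub_exp_le {x y z η : ℝ} (hη : 0 < η) :
    ‖Complex.exp ((x + y + z : ℝ) * Complex.I) - Complex.exp (x * Complex.I)‖
      ≤ η / 2 + η⁻¹ * (1 - (Complex.exp (y * Complex.I)).re) + |z| := by
  have h1 : Complex.exp ((x + y + z : ℝ) * Complex.I) - Complex.exp (x * Complex.I)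
      = Complex.exp (x * Complex.I) * (Complex.exp (y * Complex.I)
        * (Complex.exp (z * Complex.I) - 1) + (Complex.exp (y * Complex.I) - 1)) := by
    have : ((x + y + z : ℝ) : ℂ) * Complex.I
        = x * Complex.I + y * Complex.I + z * Complex.I := by push_cast; ring
    rw [this, Complex.exp_add, Complex.exp_add]
    ring
  have h2 : ‖Complex.exp (z * Complex.I) - 1‖ ≤ |z| := by
    rw [mul_comm]; exact Real.norm_exp_I_mul_ofReal_sub_one_le
  have h3 : ‖Complex.exp (y * Complex.I) - 1‖ ^ 2 = 2 * (1 - (Complex.exp (y * Complex.I)).re) := by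
    rw [← Complex.normSq_eq_norm_sq, Complex.normSq_apply]
    simp only [Complex.sub_re, Complex.sub_im, Complex.exp_ofReal_mul_I_re,
      Complex.exp_ofReal_mul_I_im, Complex.one_re, Complex.one_im]
    nlinarith [Real.sin_sq_add_cos_sq y]
  have h4 : ‖Complex.exp (y * Complex.I) - 1‖
      ≤ η / 2 + η⁻¹ * (1 - (Complex.exp (y * Complex.I)).re) := by
    set t := ‖Complex.exp (y * Complex.I) - 1‖ with ht
    have h5 : 1 - (Complex.exp (y * Complex.I)).re = t ^ 2 / 2 := by rw [h3]; ring
    rw [h5]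
    have h6 : η * t ≤ η * (η / 2 + η⁻¹ * (t ^ 2 / 2)) := by
      rw [mul_add, ← mul_assoc, mul_inv_cancel₀ hη.ne']
      nlinarith [sq_nonneg (η - t)]
    exact le_of_mul_le_mul_left h6 hη
  rw [h1, norm_mul, Complex.norm_exp_ofReal_mul_I, one_mul]
  refine (norm_add_le _ _).trans ?_
  rw [norm_mul, Complex.norm_exp_ofReal_mul_I, one_mul]
  linarith

lemma norm_integral_exp_sub_le [IsProbabilityMeasure (ℙ : Measure Ω)] {S U V : Ω → ℝ} {η ρ : ℝ}
    (hη : 0 < η) (hS : Measurable S) (hU : Measurable U) (hV : Measurable V)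
    (hρ : ∀ ω, |S ω - U ω - V ω| ≤ ρ) :
    ‖(∫ ω, Complex.exp ((S ω : ℝ) * Complex.I)) - ∫ ω, Complex.exp ((U ω : ℝ) * Complex.I)‖
      ≤ η / 2 + η⁻¹ * (1 - (∫ ω, Complex.exp ((V ω : ℝ) * Complex.I)).re) + ρ := by
  have hconv : ∀ {W : Ω → ℝ}, Measurable W →
      Integrable fun ω => Complex.exp ((W ω : ℝ) * Complex.I) := fun {W} hW =>
    Integrable.of_bound (by fun_prop) 1
      (Eventually.of_forall fun ω => by rw [Complex.norm_exp_ofReal_mul_I])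
  have hre : (∫ ω, Complex.exp ((V ω : ℝ) * Complex.I)).re
      = ∫ ω, (Complex.exp ((V ω : ℝ) * Complex.I)).re := (integral_re (hconv hV)).symm
  have hrei : Integrable fun ω => (Complex.exp ((V ω : ℝ) * Complex.I)).re := (hconv hV).re
  have hrhs : η / 2 + η⁻¹ * (1 - (∫ ω, Complex.exp ((V ω : ℝ) * Complex.I)).re) + ρ
      = ∫ ω, (η / 2 + η⁻¹ * (1 - (Complex.exp ((V ω : ℝ) * Complex.I)).re) + ρ) := by
    have hi1 : Integrable fun ω => 1 - (Complex.exp ((V ω : ℝ) * Complex.I)).re :=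
      (integrable_const _).sub hrei
    have hi2 : Integrable fun ω => η / 2 + η⁻¹ * (1 - (Complex.exp ((V ω : ℝ) * Complex.I)).re) :=
      (integrable_const _).add (hi1.const_mul _)
    rw [integral_add hi2 (integrable_const _), integral_add (integrable_const _) (hi1.const_mul _),
      integral_const_mul, integral_sub (integrable_const _) hrei, hre]
    simp
  rw [← integral_sub (hconv hS) (hconv hU), hrhs]
  refine norm_integral_le_of_norm_le ?_ (Eventually.of_forall fun ω => ?_)
  · exact ((integrable_const _).add (((integrable_const _).sub hrei).const_mul _)).add
      (integrable_const _)
  · have h := norm_exp_add_add_sub_exp_le (x := U ω) (y := V ω) (z := S ω - U ω - V ω) hη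
    have e : U ω + V ω + (S ω - U ω - V ω) = S ω := by ring
    rw [e] at h
    exact h.trans (by linarith [hρ ω])

lemma devSum_eq_blocks {Ω : Type*} (X : ℕ → Ω → ℝ) (u c : ℝ) (n p q : ℕ) (ω : Ω) :
    devSum X u c 0 n ω
      = ∑ j ∈ Finset.range (n / (p + q)), devSum X u c (0 + j * (p + q)) p ω
        + ∑ j ∈ Finset.range (n / (p + q)), devSum X u c (p + j * (p + q)) q ω
        + devSum X u c (n / (p + q) * (p + q)) (n % (p + q)) ω := by
  have h := sum_range_mul_eq (fun i => exceedDev u c (X (i + 1) ω)) p q (n / (p + q))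
  have hn : n / (p + q) * (p + q) + n % (p + q) = n := by
    rw [mul_comm]; exact Nat.div_add_mod _ _
  unfold devSum
  simp only [add_right_comm _ 1]
  conv_lhs => rw [← hn, Finset.sum_range_add]
  simp only [zero_add]
  rw [h]

lemma tendsto_charFun_devSum [IsProbabilityMeasure (ℙ : Measure Ω)] {X : ℕ → Ω → ℝ}
    (hX : ∀ i, Measurable (X i)) (hstat : IsStationary X) {k r : ℕ → ℕ} {u : ℕ → ℝ} {v : ℝ}
    (hr : Tendsto (fun n => (r n : ℝ)) atTop atTop)
    (hrn : Tendsto (fun n => (r n : ℝ) / n) atTop (𝓝 0))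
    (hrk : Tendsto (fun n => ((r n : ℝ) ^ 2 / k n)) atTop (𝓝 0))
    (hβ : ∀ ε : ℝ, 0 < ε →
      Tendsto (fun n : ℕ => ((n : ℝ) / r n) * betaMix X ⌊ε * r n⌋₊) atTop (𝓝 0))
    (hvar : ∀ a : ℝ, 0 < a → a < 1 → Tendsto (fun n : ℕ => (n : ℝ) / (⌊a * r n⌋₊ * k n)
      * ∫ ω, devSum X (u n) (tailDF (Measure.map (X 1) (ℙ : Measure Ω)) (u n)) 0 ⌊a * r n⌋₊ ω ^ 2)
      atTop (𝓝 v)) (θ : ℝ) :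
    Tendsto (fun n : ℕ => ∫ ω, Complex.exp ((θ *
        (devSum X (u n) (tailDF (Measure.map (X 1) (ℙ : Measure Ω)) (u n)) 0 n ω
          / Real.sqrt (k n)) : ℝ) * Complex.I))
      atTop (𝓝 (Real.exp (-(θ ^ 2 * v / 2)) : ℝ)) := by
  set F : ℕ → ℝ := fun n => tailDF (Measure.map (X 1) (ℙ : Measure Ω)) (u n) with hF
  have hF0 : ∀ n, 0 ≤ F n := fun n => tailDF_nonneg _ _
  have hF1 : ∀ n, F n ≤ 1 := fun n => tailDF_le_one hX _
  rw [Metric.tendsto_nhds]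
  intro δ hδ
  set t := -(θ ^ 2 * v / 2) with ht
  -- limits of the error terms as the small blocks shrink
  have hsmall : ∀ᶠ ε in 𝓝[>] (0 : ℝ), |Real.exp (t * (1 / 2 * (1 / 2 + ε)⁻¹)) - Real.exp t|
      + (δ / 2 + δ⁻¹ * (1 - Real.exp (t * (ε * (ε + 1 / 2)⁻¹)))) < δ := by
    have hc : ContinuousAt (fun ε : ℝ => |Real.exp (t * (1 / 2 * (1 / 2 + ε)⁻¹)) - Real.exp t|
      + (δ / 2 + δ⁻¹ * (1 - Real.exp (t * (ε * (ε + 1 / 2)⁻¹))))) 0 := by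
      have h1 : ContinuousAt (fun ε : ℝ => (1 / 2 + ε)⁻¹) 0 :=
        ContinuousAt.inv₀ (by fun_prop) (by norm_num)
      have h2 : ContinuousAt (fun ε : ℝ => (ε + 1 / 2)⁻¹) 0 :=
        ContinuousAt.inv₀ (by fun_prop) (by norm_num)
      fun_prop
    have hval : |Real.exp (t * (1 / 2 * (1 / 2 + 0)⁻¹)) - Real.exp t|
      + (δ / 2 + δ⁻¹ * (1 - Real.exp (t * (0 * (0 + 1 / 2)⁻¹)))) < δ := by
      norm_num
      linarith
    exact (hc.tendsto.eventually (gt_mem_nhds hval)).filter_mono nhdsWithin_le_nhds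
  obtain ⟨ε, hε, hε1 : 0 < ε, hε2 : ε < 1⟩ :=
    (hsmall.and (Ioo_mem_nhdsGT (zero_lt_one' ℝ))).exists
  set p : ℕ → ℕ := fun n => ⌊(1 / 2 : ℝ) * r n⌋₊ with hp
  set q : ℕ → ℕ := fun n => ⌊ε * r n⌋₊ with hq
  have hU := tendsto_charFun_blocks hX hstat hr hrn hrk hβ hvar (a := 1 / 2) (by norm_num)
    (by norm_num) hε1 (fun _ => 0) θ
  have hV := tendsto_charFun_blocks hX hstat hr hrn hrk hβ hvar hε1 hε2 (c := 1 / 2) (by norm_num)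
    p θ
  rw [← ht] at hU hV
  let U : ℕ → Ω → ℝ := fun n ω => θ * ((∑ j ∈ Finset.range (n / (p n + q n)),
    devSum X (u n) (F n) (0 + j * (p n + q n)) (p n) ω) / Real.sqrt (k n))
  let V : ℕ → Ω → ℝ := fun n ω => θ * ((∑ j ∈ Finset.range (n / (p n + q n)),
    devSum X (u n) (F n) (p n + j * (p n + q n)) (q n) ω) / Real.sqrt (k n))
  let S : ℕ → Ω → ℝ := fun n ω => θ * (devSum X (u n) (F n) 0 n ω / Real.sqrt (k n))
  have hU' : Tendsto (fun n => ∫ ω, Complex.exp ((U n ω : ℝ) * Complex.I)) atTop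
      (𝓝 (Real.exp (t * (1 / 2 * (1 / 2 + ε)⁻¹)) : ℝ)) := hU
  have hV' : Tendsto (fun n => ∫ ω, Complex.exp ((V n ω : ℝ) * Complex.I)) atTop
      (𝓝 (Real.exp (t * (ε * (ε + 1 / 2)⁻¹)) : ℝ)) := by
    refine hV.congr fun n => ?_
    simp only [V, hp, hq, hF, add_comm ⌊ε * (r n : ℝ)⌋₊]
  have hρ0 : Tendsto (fun n => |θ| * (2 * (r n / Real.sqrt (k n)))) atTop (𝓝 0) := by
    have := ((tendsto_div_sqrt_zero hrk).const_mul 2).const_mul |θ|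
    simpa using this
  have hρ : ∀ n ω, p n + q n ≠ 0 →
      |S n ω - U n ω - V n ω| ≤ |θ| * (2 * (r n / Real.sqrt (k n))) := by
    intro n ω hpq
    have e : S n ω - U n ω - V n ω = θ * (devSum X (u n) (F n)
        (n / (p n + q n) * (p n + q n)) (n % (p n + q n)) ω / Real.sqrt (k n)) := by
      simp only [S, U, V]
      rw [devSum_eq_blocks X (u n) (F n) n (p n) (q n) ω]
      ring
    rw [e, abs_mul, abs_div, abs_of_nonneg (Real.sqrt_nonneg _), ← mul_div_assoc 2]
    refine mul_le_mul_of_nonneg_left (div_le_div_of_nonneg_right ?_ (Real.sqrt_nonneg _))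
      (abs_nonneg _)
    refine (abs_devSum_le (hF0 n) (hF1 n) _ _ _).trans ?_
    have h1 : n % (p n + q n) ≤ 2 * r n := by
      have := Nat.mod_lt n (Nat.pos_of_ne_zero hpq)
      have h2 : p n ≤ r n := floor_mul_le (by norm_num) _
      have h3 : q n ≤ r n := floor_mul_le hε2 _
      omega
    exact_mod_cast h1
  have hSm : ∀ n, Measurable (S n) := fun n =>
    ((measurable_devSum hX _ _ _ _).div_const _).const_mul _
  have hUm : ∀ n, Measurable (U n) := fun n =>
    ((Finset.measurable_sum _ fun _ _ => measurable_devSum hX _ _ _ _).div_const _).const_mul _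
  have hVm : ∀ n, Measurable (V n) := fun n =>
    ((Finset.measurable_sum _ fun _ _ => measurable_devSum hX _ _ _ _).div_const _).const_mul _
  have hbound : Tendsto (fun n => ‖(∫ ω, Complex.exp ((U n ω : ℝ) * Complex.I))
        - (Real.exp t : ℝ)‖
      + (δ / 2 + δ⁻¹ * (1 - (∫ ω, Complex.exp ((V n ω : ℝ) * Complex.I)).re)
        + |θ| * (2 * (r n / Real.sqrt (k n))))) atTop
      (𝓝 (|Real.exp (t * (1 / 2 * (1 / 2 + ε)⁻¹)) - Real.exp t|
      + (δ / 2 + δ⁻¹ * (1 - Real.exp (t * (ε * (ε + 1 / 2)⁻¹))) + 0))) := by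
    refine Tendsto.add ?_ ((tendsto_const_nhds.add (Tendsto.const_mul _ ?_)).add hρ0)
    · have := (hU'.sub_const ((Real.exp t : ℝ) : ℂ)).norm
      rwa [← Complex.ofReal_sub, Complex.norm_real, Real.norm_eq_abs] at this
    · have := ((Complex.continuous_re.tendsto _).comp hV').const_sub 1
      simpa only [Complex.ofReal_re, Function.comp_apply] using this
  rw [add_zero] at hbound
  filter_upwards [hbound.eventually (gt_mem_nhds hε),
    eventually_floor_mul_pos hr hε1] with n hn hqn
  rw [dist_eq_norm]
  have hq0 : p n + q n ≠ 0 := by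
    have : 0 < q n := hqn
    omega
  have h := norm_integral_exp_sub_le hδ (hSm n) (hUm n) (hVm n) (fun ω => hρ n ω hq0)
  refine lt_of_le_of_lt ?_ hn
  calc _ ≤ ‖(∫ ω, Complex.exp ((S n ω : ℝ) * Complex.I))
          - ∫ ω, Complex.exp ((U n ω : ℝ) * Complex.I)‖
        + ‖(∫ ω, Complex.exp ((U n ω : ℝ) * Complex.I)) - (Real.exp t : ℝ)‖ :=
        norm_sub_le_norm_sub_add_norm_sub _ _ _
    _ ≤ _ := by linarith

lemma tendsto_block_variance [IsProbabilityMeasure (ℙ : Measure Ω)] {X : ℕ → Ω → ℝ}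
    (hX : ∀ i, Measurable (X i)) (hstat : IsStationary X) {k r : ℕ → ℕ} {b u : ℕ → ℝ} {ωc z : ℝ}
    (hk : TailFraction k) (hr : Tendsto (fun n => (r n : ℝ)) atTop atTop)
    (hrk : Tendsto (fun n => ((r n : ℝ) ^ 2 / k n)) atTop (𝓝 0))
    (hb : Tendsto (fun n : ℕ => (n : ℝ) / k n * tailDF (Measure.map (X 1) (ℙ : Measure Ω)) (b n))
      atTop (𝓝 1))
    (hbu : Tendsto (fun n : ℕ => ((n : ℝ) / k n * tailDF (Measure.map (X 1) (ℙ : Measure Ω)) (u n)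
      - (n : ℝ) / k n * tailDF (Measure.map (X 1) (ℙ : Measure Ω)) (b n)) * Real.sqrt (k n))
      atTop (𝓝 z))
    (hcov : ∀ a : ℝ, 0 < a → a < 1 → Tendsto (fun n : ℕ =>
        (2 * (n : ℝ) / ((⌊a * r n⌋₊ : ℝ) * k n)) * ∑ q ∈ pairsUpTo ⌊a * r n⌋₊,
            cov (fun ω => if b n < X q.1 ω then (1 : ℝ) else 0)
                (fun ω => if b n < X q.2 ω then (1 : ℝ) else 0)) atTop (𝓝 ωc))
    {a : ℝ} (ha : 0 < a) (ha1 : a < 1) :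
    Tendsto (fun n : ℕ => (n : ℝ) / (⌊a * r n⌋₊ * k n)
      * ∫ ω, devSum X (u n) (tailDF (Measure.map (X 1) (ℙ : Measure Ω)) (u n)) 0 ⌊a * r n⌋₊ ω ^ 2)
      atTop (𝓝 (1 + ωc)) := by
  set F := tailDF (Measure.map (X 1) (ℙ : Measure Ω)) with hF
  set p : ℕ → ℕ := fun n => ⌊a * r n⌋₊ with hp
  have hF0 : ∀ x, 0 ≤ F x := fun x => tailDF_nonneg _ _
  have hF1 : ∀ x, F x ≤ 1 := fun x => tailDF_le_one hX _
  have hne : ∀ᶠ n : ℕ in atTop, (n : ℝ) ≠ 0 ∧ (p n : ℝ) ≠ 0 ∧ (k n : ℝ) ≠ 0 := by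
    filter_upwards [eventually_gt_atTop 0, eventually_floor_mul_pos hr ha,
      hk.1.eventually_gt_atTop 0] with n h1 h2 h3
    exact ⟨by exact_mod_cast h1.ne', by exact_mod_cast h2.ne', h3.ne'⟩
  have hFb : Tendsto (fun n => F (b n)) atTop (𝓝 0) := by
    have h := hb.mul hk.2
    rw [mul_zero] at h
    refine h.congr' ?_
    filter_upwards [hne] with n ⟨h1, _, h3⟩
    field_simp
  have hvarb : Tendsto (fun n : ℕ => (n : ℝ) / (p n * k n)
      * ∫ ω, devSum X (b n) (F (b n)) 0 (p n) ω ^ 2) atTop (𝓝 (1 + ωc)) := by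
    have h := (hb.mul (hFb.const_sub 1)).add (hcov a ha ha1)
    rw [sub_zero, mul_one] at h
    refine h.congr' ?_
    filter_upwards [hne] with n ⟨h1, h2, h3⟩
    rw [integral_devSum_sq hX hstat, ← hF, mul_add]
    congr 1
    · field_simp
    · ring
  refine tendsto_mul_integral_sq_of_sub (C := fun n => (p n : ℝ)) (fun n => by positivity)
    (fun n => measurable_devSum hX (b n) (F (b n)) 0 (p n))
    (fun n => measurable_devSum hX (u n) (F (u n)) 0 (p n))
    (fun n ω => abs_devSum_le (hF0 _) (hF1 _) _ _ _)
    (fun n ω => abs_devSum_le (hF0 _) (hF1 _) _ _ _) hvarb ?_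
  have hz := (tendsto_div_sqrt_zero hrk).mul hbu.abs
  rw [zero_mul] at hz
  refine squeeze_zero' (Eventually.of_forall fun n =>
    mul_nonneg (by positivity) (integral_nonneg fun ω => sq_nonneg _)) ?_ hz
  filter_upwards [hne] with n ⟨h1, h2, h3⟩
  have hpr : (p n : ℝ) ≤ r n := Nat.cast_le.2 (floor_mul_le ha1 _)
  have hsq : (0 : ℝ) < Real.sqrt (k n) :=
    Real.sqrt_pos.2 (lt_of_le_of_ne (Nat.cast_nonneg _) (Ne.symm h3))
  have hnk : (0 : ℝ) ≤ n / k n := by positivity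
  calc (n : ℝ) / (p n * k n)
        * ∫ ω, (devSum X (u n) (F (u n)) 0 (p n) ω - devSum X (b n) (F (b n)) 0 (p n) ω) ^ 2
      ≤ (n : ℝ) / (p n * k n) * (p n ^ 2 * |F (u n) - F (b n)|) :=
        mul_le_mul_of_nonneg_left (integral_devSum_sub_devSum_sq_le hX hstat _ _ _) (by positivity)
    _ = p n * ((n : ℝ) / k n * |F (u n) - F (b n)|) := by field_simp
    _ ≤ r n * ((n : ℝ) / k n * |F (u n) - F (b n)|) := by gcongr
    _ = r n / Real.sqrt (k n) * |((n : ℝ) / k n * F (u n) - (n : ℝ) / k n * F (b n))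
          * Real.sqrt (k n)| := by
        rw [← mul_sub, abs_mul, abs_mul, abs_of_nonneg hnk, abs_of_nonneg hsq.le]
        field_simp

lemma betaMix_le_betaMix_zero [IsProbabilityMeasure (ℙ : Measure Ω)] {X : ℕ → Ω → ℝ}
    (hX : ∀ i, Measurable (X i)) (lag : ℕ) : betaMix X lag ≤ betaMix X 0 := by
  have : ∀ m : ℕ, Nonempty (Subtype (MeasurableSet : Set ((Fin m → ℝ) × (ℕ → ℝ)) → Prop)) :=
    fun m => ⟨⟨∅, MeasurableSet.empty⟩⟩
  refine ciSup_le fun m => ciSup_le fun ⟨S, hS⟩ => ?_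
  have h1 : Measurable (fun ω => fun i : Fin m => X ((i : ℕ) + 1) ω) :=
    measurable_pi_lambda _ fun i => hX _
  have h2 : Measurable (fun ω => fun i : ℕ => X (m + 0 + 1 + i) ω) :=
    measurable_pi_lambda _ fun i => hX _
  have hsh : Measurable (fun x : ℕ → ℝ => fun i : ℕ => x (lag + i)) :=
    measurable_pi_lambda _ fun i => measurable_pi_apply _
  have := Measure.isProbabilityMeasure_map (μ := (ℙ : Measure Ω)) h1.aemeasurable
  have := Measure.isProbabilityMeasure_map (μ := (ℙ : Measure Ω)) h2.aemeasurable
  have hshift : (fun ω => fun i : ℕ => X (m + lag + 1 + i) ω)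
      = (fun x : ℕ → ℝ => fun i : ℕ => x (lag + i)) ∘ fun ω => fun i : ℕ => X (m + 0 + 1 + i) ω := by
    funext ω i
    simp only [Function.comp_apply]
    congr 1
    omega
  have hmapm : Measurable (Prod.map id (fun x : ℕ → ℝ => fun i : ℕ => x (lag + i))
      : (Fin m → ℝ) × (ℕ → ℝ) → (Fin m → ℝ) × (ℕ → ℝ)) := measurable_id.prodMap hsh
  have hjoint : Measure.map (fun ω => ((fun i : Fin m => X ((i : ℕ) + 1) ω,
        fun i : ℕ => X (m + lag + 1 + i) ω))) (ℙ : Measure Ω)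
      = Measure.map (Prod.map id (fun x : ℕ → ℝ => fun i : ℕ => x (lag + i)))
        (Measure.map (fun ω => ((fun i : Fin m => X ((i : ℕ) + 1) ω,
          fun i : ℕ => X (m + 0 + 1 + i) ω))) (ℙ : Measure Ω)) := by
    rw [Measure.map_map hmapm (h1.prodMk h2)]
    congr 1
    funext ω
    exact Prod.ext rfl (congrFun hshift ω)
  have hprod : (Measure.map (fun ω => fun i : Fin m => X ((i : ℕ) + 1) ω) (ℙ : Measure Ω)).prod
        (Measure.map (fun ω => fun i : ℕ => X (m + lag + 1 + i) ω) (ℙ : Measure Ω))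
      = Measure.map (Prod.map id (fun x : ℕ → ℝ => fun i : ℕ => x (lag + i)))
        ((Measure.map (fun ω => fun i : Fin m => X ((i : ℕ) + 1) ω) (ℙ : Measure Ω)).prod
          (Measure.map (fun ω => fun i : ℕ => X (m + 0 + 1 + i) ω) (ℙ : Measure Ω))) := by
    rw [← Measure.map_prod_map _ _ measurable_id hsh, Measure.map_id, hshift,
      Measure.map_map hsh h2]
  rw [hjoint, hprod, Measure.map_apply hmapm hS, Measure.map_apply hmapm hS]
  exact abs_joint_sub_prod_le_betaMix hX 0 m (hmapm hS)

lemma cov_exceed_eq_zero [IsProbabilityMeasure (ℙ : Measure Ω)] {X : ℕ → Ω → ℝ}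
    (hX : ∀ i, Measurable (X i)) (hβ : betaMix X 0 = 0) (b : ℝ) {i j : ℕ} (hi : 1 ≤ i)
    (hij : i < j) :
    cov (fun ω => if b < X i ω then (1 : ℝ) else 0) (fun ω => if b < X j ω then (1 : ℝ) else 0)
      = 0 := by
  obtain ⟨i, rfl⟩ := Nat.exists_eq_add_of_le' hi
  obtain ⟨d, rfl⟩ := Nat.exists_eq_add_of_lt hij
  have h := norm_integral_mul_sub_le_betaMix hX 0 (i + 1)
    (F := fun v => ((if b < v (Fin.last i) then (1 : ℝ) else 0 : ℝ) : ℂ))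
    (G := fun x => ((if b < x d then (1 : ℝ) else 0 : ℝ) : ℂ))
    (Complex.measurable_ofReal.comp (Measurable.ite (measurableSet_lt measurable_const
      (measurable_pi_apply _)) measurable_const measurable_const))
    (Complex.measurable_ofReal.comp (Measurable.ite (measurableSet_lt measurable_const
      (measurable_pi_apply _)) measurable_const measurable_const))
    (fun v => by split_ifs <;> simp) (fun x => by split_ifs <;> simp)
  rw [hβ, mul_zero, norm_le_zero_iff, sub_eq_zero] at h
  simp only [← Complex.ofReal_mul, integral_complex_ofReal] at h
  have h' := Complex.ofReal_injective h
  simp only [Fin.val_last] at h'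
  have hidx : i + 1 + 0 + 1 + d = i + 1 + d + 1 := by omega
  simp only [hidx] at h'
  unfold cov
  set f : Ω → ℝ := fun ω => if b < X (i + 1) ω then (1 : ℝ) else 0 with hf
  set g : Ω → ℝ := fun ω => if b < X (i + 1 + d + 1) ω then (1 : ℝ) else 0 with hg
  have hfi : Integrable f := integrable_exceed hX _ b
  have hgi : Integrable g := integrable_exceed hX _ b
  have hfgi : Integrable fun ω => f ω * g ω := by
    refine integrable_of_measurable_of_abs_le (C := 1)
      ((measurable_exceed hX _ b).mul (measurable_exceed hX _ b)) fun ω => ?_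
    simp only [hf, hg]
    split_ifs <;> simp
  have hexp : ∀ ω, (f ω - ∫ ω', f ω') * (g ω - ∫ ω', g ω')
      = f ω * g ω - (∫ ω', g ω') * f ω - (∫ ω', f ω') * g ω + (∫ ω', f ω') * ∫ ω', g ω' :=
    fun ω => by ring
  simp only [hexp]
  have hi1 : Integrable fun ω => f ω * g ω - (∫ ω', g ω') * f ω := hfgi.sub (hfi.const_mul _)
  have hi2 : Integrable fun ω => f ω * g ω - (∫ ω', g ω') * f ω - (∫ ω', f ω') * g ω :=
    hi1.sub (hgi.const_mul _)
  rw [integral_add hi2 (integrable_const _), integral_sub hi1 (hgi.const_mul _),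
    integral_sub hfgi (hfi.const_mul _), integral_const_mul, integral_const_mul]
  have h'' : ∫ ω, f ω * g ω = (∫ ω, f ω) * ∫ ω, g ω := h'
  rw [h'']
  simp
  ring

lemma betaMix_zero_eq_zero_of_not_tendsto {X : ℕ → Ω → ℝ} {r : ℕ → ℕ} (hr0 : ∀ n, 0 < r n)
    (hβ : ∀ ε : ℝ, 0 < ε →
      Tendsto (fun n : ℕ => ((n : ℝ) / r n) * betaMix X ⌊ε * r n⌋₊) atTop (𝓝 0))
    (hr : ¬ Tendsto (fun n => (r n : ℝ)) atTop atTop) : betaMix X 0 = 0 := by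
  by_contra hne
  have hpos : 0 < betaMix X 0 := lt_of_le_of_ne (betaMix_nonneg 0) (Ne.symm hne)
  rw [tendsto_atTop] at hr
  push Not at hr
  obtain ⟨M, hM⟩ := hr
  set M' := max M 1 with hM'
  have hM1 : 1 ≤ M' := le_max_right _ _
  have hlim := hβ M'⁻¹ (by positivity)
  have hev : ∀ᶠ n : ℕ in atTop, 1 ≤ (n : ℝ) / M' * betaMix X 0 := by
    have : Tendsto (fun n : ℕ => (n : ℝ) / M' * betaMix X 0) atTop atTop :=
      (tendsto_natCast_atTop_atTop.atTop_div_const (by positivity)).atTop_mul_const hpos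
    exact this.eventually_ge_atTop 1
  obtain ⟨n, hnM, hn1, hn2⟩ :=
    (hM.and_eventually (hev.and (hlim.eventually (gt_mem_nhds one_pos)))).exists
  have hrM : (r n : ℝ) < M' := hnM.trans_le (le_max_left _ _)
  have hfl : ⌊M'⁻¹ * (r n : ℝ)⌋₊ = 0 := by
    rw [Nat.floor_eq_zero, inv_mul_lt_iff₀ (by positivity), mul_one]
    exact hrM
  rw [hfl] at hn2
  have hrn : (0 : ℝ) < r n := Nat.cast_pos.2 (hr0 n)
  have : (n : ℝ) / M' * betaMix X 0 ≤ (n : ℝ) / r n * betaMix X 0 := by gcongr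
  linarith

/-- The block length may be assumed to tend to infinity. -/
lemma exists_blockLength_tendsto_atTop [IsProbabilityMeasure (ℙ : Measure Ω)] {X : ℕ → Ω → ℝ}
    (hX : ∀ i, Measurable (X i)) {k r : ℕ → ℕ} (hk : TailFraction k) (hA1 : CondA1 X k r)
    {b : ℝ → ℝ} {α χ ωc : ℝ} (hA3 : CondA3 X b k r α χ ωc) :
    ∃ r' : ℕ → ℕ, Tendsto (fun n => (r' n : ℝ)) atTop atTop ∧
      Tendsto (fun n => ((r' n : ℝ) ^ 2 / k n)) atTop (𝓝 0) ∧
      (∀ ε : ℝ, 0 < ε →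
        Tendsto (fun n : ℕ => ((n : ℝ) / r' n) * betaMix X ⌊ε * r' n⌋₊) atTop (𝓝 0)) ∧
      ∀ a : ℝ, 0 < a → a < 1 → Tendsto (fun n : ℕ =>
        (2 * (n : ℝ) / ((⌊a * r' n⌋₊ : ℝ) * k n)) * ∑ q ∈ pairsUpTo ⌊a * r' n⌋₊,
            cov (fun ω => if b ((n : ℝ) / k n) < X q.1 ω then (1 : ℝ) else 0)
                (fun ω => if b ((n : ℝ) / k n) < X q.2 ω then (1 : ℝ) else 0)) atTop (𝓝 ωc) := by
  by_cases hr : Tendsto (fun n => (r n : ℝ)) atTop atTop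
  · exact ⟨r, hr, hA1.2.2, hA1.2.1, fun a ha ha1 => (hA3.2.2 a ha ha1).2⟩
  have hβ0 := betaMix_zero_eq_zero_of_not_tendsto hA1.1 hA1.2.1 hr
  have hβ : ∀ lag, betaMix X lag = 0 := fun lag =>
    le_antisymm (hβ0 ▸ betaMix_le_betaMix_zero hX lag) (betaMix_nonneg lag)
  have hsum : ∀ (N : ℕ) (x : ℝ), ∑ q ∈ pairsUpTo N,
      cov (fun ω => if x < X q.1 ω then (1 : ℝ) else 0)
        (fun ω => if x < X q.2 ω then (1 : ℝ) else 0) = 0 := fun N x => by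
    refine Finset.sum_eq_zero fun q hq => ?_
    simp only [pairsUpTo, Finset.mem_filter, Finset.mem_product, Finset.mem_Icc] at hq
    exact cov_exceed_eq_zero hX hβ0 x hq.1.1.1 hq.2
  have hω : ωc = 0 := by
    have h := (hA3.2.2 (1 / 2) (by norm_num) (by norm_num)).2
    simp only [hsum, mul_zero] at h
    exact tendsto_nhds_unique h tendsto_const_nhds
  have hroot : Tendsto (fun n => Real.sqrt (Real.sqrt (k n))) atTop atTop :=
    Real.tendsto_sqrt_atTop.comp (Real.tendsto_sqrt_atTop.comp hk.1)
  refine ⟨fun n => ⌊Real.sqrt (Real.sqrt (k n))⌋₊,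
    tendsto_natCast_atTop_atTop.comp (tendsto_nat_floor_atTop.comp hroot), ?_, ?_, ?_⟩
  · refine squeeze_zero (fun n => by positivity) (fun n => ?_)
      (tendsto_sqrt_atTop_of_tailFraction hk).inv_tendsto_atTop
    have h1 : ((⌊Real.sqrt (Real.sqrt (k n))⌋₊ : ℕ) : ℝ) ^ 2 ≤ Real.sqrt (k n) := by
      rw [← Real.le_sqrt (Nat.cast_nonneg _) (Real.sqrt_nonneg _)]
      exact Nat.floor_le (Real.sqrt_nonneg _)
    refine (div_le_div_of_nonneg_right h1 (Nat.cast_nonneg _)).trans (le_of_eq ?_)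
    rw [Real.sqrt_div_self', one_div]
    rfl
  · intro ε _
    simp only [hβ, mul_zero]
    exact tendsto_const_nhds
  · intro a _ _
    simp only [hsum, mul_zero, hω]
    exact tendsto_const_nhds

lemma tendsto_blockLength_div_zero {k r : ℕ → ℕ} (hk : TailFraction k)
    (hrk : Tendsto (fun n => ((r n : ℝ) ^ 2 / k n)) atTop (𝓝 0)) :
    Tendsto (fun n => (r n : ℝ) / n) atTop (𝓝 0) := by
  have h := hrk.mul hk.2
  rw [mul_zero] at h
  refine squeeze_zero' (Eventually.of_forall fun n => by positivity) ?_ h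
  filter_upwards [hk.1.eventually_gt_atTop 0] with n hn
  rw [div_mul_div_cancel₀ hn.ne']
  refine div_le_div_of_nonneg_right ?_ (Nat.cast_nonneg _)
  exact_mod_cast Nat.le_self_pow two_ne_zero _

lemma tendsto_charFun_count [IsProbabilityMeasure (ℙ : Measure Ω)]
    {X : ℕ → Ω → ℝ} (hX : ∀ i, Measurable (X i)) (hpos : ∀ i ω, 0 ≤ X i ω)
    (hstat : IsStationary X) {α : ℝ} {l : ℝ → ℝ}
    (hF : ParetoTail (Measure.map (X 1) (ℙ : Measure Ω)) α l)
    {k r : ℕ → ℕ} (hk : TailFraction k) (hA1 : CondA1 X k r) {g : ℝ → ℝ} {K γ A : ℝ}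
    (hA2 : CondA2 l g K γ A (quantileB (Measure.map (X 1) (ℙ : Measure Ω))) k) {χ ωc : ℝ}
    (hA3 : CondA3 X (quantileB (Measure.map (X 1) (ℙ : Measure Ω))) k r α χ ωc) (z θ : ℝ) :
    Tendsto (fun n : ℕ => ∫ ω, Complex.exp ((θ *
        (((∑ i ∈ Finset.Icc 1 n, if Real.exp (Real.log (quantileB
            (Measure.map (X 1) (ℙ : Measure Ω)) ((n : ℝ) / k n)) - z / Real.sqrt (k n)) < X i ω
              then (1 : ℝ) else 0) - k n) / Real.sqrt (k n)) : ℝ) * Complex.I))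
      atTop (𝓝 (Complex.exp (θ * (α * z : ℝ) * Complex.I - (1 + ωc : ℝ) * θ ^ 2 / 2))) := by
  set μ : Measure ℝ := Measure.map (X 1) (ℙ : Measure Ω) with hμdef
  have hμp : IsProbabilityMeasure μ := Measure.isProbabilityMeasure_map (hX 1).aemeasurable
  have hμ : μ (Iio 0) = 0 := by
    rw [hμdef, Measure.map_apply (hX 1) measurableSet_Iio]
    convert measure_empty (μ := (ℙ : Measure Ω))
    ext ω
    simpa using hpos 1 ω
  obtain ⟨r', hr, hrk, hβ, hcov⟩ := exists_blockLength_tendsto_atTop hX hk hA1 hA3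
  have hs := tendsto_sqrt_atTop_of_tailFraction hk
  have hq := tendsto_quantileB_ratio hF hk
  set b : ℕ → ℝ := fun n => quantileB μ ((n : ℝ) / k n) with hbdef
  set u : ℕ → ℝ := fun n => Real.exp (Real.log (quantileB μ ((n : ℝ) / k n)) - z / Real.sqrt (k n))
    with hudef
  have hu : Tendsto (fun n : ℕ => ((n : ℝ) / k n * tailDF μ (u n) - 1) * Real.sqrt (k n)) atTop
      (𝓝 (α * z)) := tendsto_expected_count hF hμ hk hA2 tendsto_const_nhds
  have hb0 : Tendsto (fun n : ℕ => ((n : ℝ) / k n * tailDF μ (b n) - 1) * Real.sqrt (k n)) atTop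
      (𝓝 0) := by
    have h := tendsto_expected_count hF hμ hk hA2
      (tendsto_const_nhds (x := (0 : ℝ)) (f := (atTop : Filter ℕ)))
    rw [mul_zero] at h
    refine h.congr' ?_
    filter_upwards [hq.eventually_gt_atTop 0] with n hn
    rw [zero_div, sub_zero, Real.exp_log hn]
  have hb1 : Tendsto (fun n : ℕ => (n : ℝ) / k n * tailDF μ (b n)) atTop (𝓝 1) := by
    have h := (hb0.div_atTop hs).add_const 1
    rw [zero_add] at h
    refine h.congr' ?_
    filter_upwards [hs.eventually_gt_atTop 0] with n hn
    field_simp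
    ring
  have hbu : Tendsto (fun n : ℕ => ((n : ℝ) / k n * tailDF μ (u n)
      - (n : ℝ) / k n * tailDF μ (b n)) * Real.sqrt (k n)) atTop (𝓝 (α * z)) := by
    have h := hu.sub hb0
    rw [sub_zero] at h
    exact h.congr fun n => by ring
  have hcf := tendsto_charFun_devSum hX hstat hr (tendsto_blockLength_div_zero hk hrk) hrk hβ
    (fun a ha ha1 => tendsto_block_variance hX hstat hk hr hrk hb1 hbu hcov ha ha1) θ
  have hc : Tendsto (fun n : ℕ => Complex.exp ((θ * (((n : ℝ) / k n * tailDF μ (u n) - 1)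
      * Real.sqrt (k n)) : ℝ) * Complex.I)) atTop
      (𝓝 (Complex.exp ((θ * (α * z) : ℝ) * Complex.I))) := by
    have hcont : Continuous fun x : ℝ => Complex.exp ((θ * x : ℝ) * Complex.I) := by fun_prop
    exact (hcont.tendsto _).comp hu
  have h := hc.mul hcf
  have hlim : Complex.exp ((θ * (α * z) : ℝ) * Complex.I)
      * ((Real.exp (-(θ ^ 2 * (1 + ωc) / 2)) : ℝ) : ℂ)
      = Complex.exp (θ * (α * z : ℝ) * Complex.I - (1 + ωc : ℝ) * θ ^ 2 / 2) := by
    rw [Complex.ofReal_exp, ← Complex.exp_add]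
    congr 1
    push_cast
    ring
  rw [hlim] at h
  refine h.congr' ?_
  filter_upwards [hs.eventually_gt_atTop 0] with n hn
  rw [← integral_const_mul]
  refine integral_congr_ae (Eventually.of_forall fun ω => ?_)
  have hk0 : (k n : ℝ) ≠ 0 := by
    intro h0
    simp [h0] at hn
  have hsq : (k n : ℝ) = Real.sqrt (k n) * Real.sqrt (k n) :=
    (Real.mul_self_sqrt (Nat.cast_nonneg _)).symm
  have key : (((∑ i ∈ Finset.Icc 1 n, if u n < X i ω then (1 : ℝ) else 0) - k n) / Real.sqrt (k n))
      = ((n : ℝ) / k n * tailDF μ (u n) - 1) * Real.sqrt (k n)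
        + devSum X (u n) (tailDF μ (u n)) 0 n ω / Real.sqrt (k n) := by
    rw [devSum_zero_eq_sum_Icc]
    simp only [exceedDev, Finset.sum_sub_distrib, Finset.sum_const, Nat.card_Icc, nsmul_eq_mul,
      Nat.add_sub_cancel]
    have h1 : ((n : ℝ) / k n * tailDF μ (u n) - 1) * Real.sqrt (k n)
        = (n * tailDF μ (u n) - k n) / Real.sqrt (k n) := by
      rw [eq_div_iff hn.ne', mul_assoc, ← hsq]
      field_simp
    rw [h1]
    ring
  simp only []
  rw [key, ← Complex.exp_add]
  congr 1
  push_cast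
  ring

lemma tendstoInLaw_of_tendsto_Ici [IsProbabilityMeasure (ℙ : Measure Ω)] {Y : ℕ → Ω → ℝ}
    {ν : Measure ℝ} [IsProbabilityMeasure ν] (hY : ∀ᶠ n in atTop, Measurable (Y n))
    (h : ∀ z : ℝ, Tendsto (fun n => (ℙ : Measure Ω) {ω | z ≤ Y n ω}) atTop (𝓝 (ν (Ici z)))) :
    TendstoInLaw Y ν := by
  classical
  set Y' : ℕ → Ω → ℝ := fun n => if Measurable (Y n) then Y n else fun _ => 0 with hY'
  have hm : ∀ n, Measurable (Y' n) := fun n => by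
    simp only [hY']
    split_ifs with hn
    exacts [hn, measurable_const]
  have heq : ∀ᶠ n in atTop, Y' n = Y n := hY.mono fun n hn => by simp [hY', hn]
  let P : ℕ → ProbabilityMeasure ℝ := fun n =>
    ⟨Measure.map (Y' n) (ℙ : Measure Ω), Measure.isProbabilityMeasure_map (hm n).aemeasurable⟩
  let Q : ProbabilityMeasure ℝ := ⟨ν, inferInstance⟩
  have hIci : ∀ z : ℝ, Tendsto (fun n => ((P n : Measure ℝ)).real (Ici z)) atTop
      (𝓝 (ν.real (Ici z))) := fun z => by
    have h1 : Tendsto (fun n => (P n : Measure ℝ) (Ici z)) atTop (𝓝 (ν (Ici z))) := by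
      refine (h z).congr' ?_
      filter_upwards [heq] with n hn
      change _ = Measure.map (Y' n) ℙ (Ici z)
      rw [Measure.map_apply (hm n) measurableSet_Ici, hn]
      rfl
    exact (ENNReal.tendsto_toReal (measure_ne_top _ _)).comp h1
  have hIco : ∀ (m : Measure ℝ) [IsProbabilityMeasure m] (x y : ℝ),
      m.real (Ico x y) = m.real (Ici x) - m.real (Ici (max x y)) := fun m _ x y => by
    rw [← measureReal_sdiff (Ici_subset_Ici.2 (le_max_left x y)) measurableSet_Ici]
    congr 1
    ext t
    simp only [mem_Ico, Set.mem_sdiff, mem_Ici, max_le_iff, not_and, not_le]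
    tauto
  have hlim : Tendsto P atTop (𝓝 Q) := by
    refine IsPiSystem.tendsto_probabilityMeasure_of_tendsto_of_mem
      (S := {s | ∃ x y : ℝ, s = Ico x y}) ?_ ?_ ?_ ?_
    · rintro _ ⟨x, y, rfl⟩ _ ⟨x', y', rfl⟩ -
      exact ⟨_, _, Ico_inter_Ico⟩
    · rintro _ ⟨x, y, rfl⟩
      exact measurableSet_Ico
    · intro U hU x hx
      obtain ⟨ε, hε, hball⟩ := Metric.isOpen_iff.1 hU x hx
      refine ⟨Ico (x - ε / 2) (x + ε / 2), ⟨_, _, rfl⟩,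
        Ico_mem_nhds (by linarith) (by linarith), fun t ht => hball ?_⟩
      rw [Metric.mem_ball, Real.dist_eq, abs_lt]
      exact ⟨by linarith [ht.1], by linarith [ht.2]⟩
    · rintro _ ⟨x, y, rfl⟩
      rw [← NNReal.tendsto_coe]
      have h1 := (hIci x).sub (hIci (max x y))
      rw [← hIco ν x y] at h1
      exact h1.congr fun n => (hIco (P n : Measure ℝ) x y).symm
  rintro f hf ⟨C, hC⟩
  have hconv := ProbabilityMeasure.tendsto_iff_forall_integral_tendsto.1 hlim
    (BoundedContinuousFunction.ofNormedAddCommGroup f hf C hC)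
  refine hconv.congr' ?_
  filter_upwards [heq] with n hn
  change ∫ x, f x ∂(Measure.map (Y' n) ℙ) = _
  rw [integral_map (hm n).aemeasurable hf.aestronglyMeasurable, hn]

lemma gaussianReal_Iio_zero_eq {α : ℝ} (hα : 0 < α) (z : ℝ) {v : ℝ} (hv : 0 < v) :
    gaussianReal (α * z) v.toNNReal (Iio 0)
      = gaussianReal 0 (Real.toNNReal (α⁻¹ ^ 2 * v)) (Ici z) := by
  have hvar : (NNReal.mk ((-α⁻¹) ^ 2) (sq_nonneg _)) * v.toNNReal
      = Real.toNNReal (α⁻¹ ^ 2 * v) := by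
    ext
    rw [NNReal.coe_mul, Real.coe_toNNReal _ hv.le, Real.coe_toNNReal _ (by positivity)]
    simp
  have h1 : (gaussianReal (α * z) v.toNNReal).map (fun y => -α⁻¹ * y + z)
      = gaussianReal 0 (Real.toNNReal (α⁻¹ ^ 2 * v)) := by
    have : (fun y : ℝ => -α⁻¹ * y + z) = (fun y => y + z) ∘ fun y => -α⁻¹ * y := rfl
    rw [this, ← Measure.map_map (by fun_prop) (by fun_prop), gaussianReal_map_const_mul,
      gaussianReal_map_add_const, ← hvar]
    congr 1
    field_simp
    ring
  have hne : Real.toNNReal (α⁻¹ ^ 2 * v) ≠ 0 := by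
    rw [Ne, Real.toNNReal_eq_zero, not_le]
    positivity
  have := nullSingletonClass_gaussianReal (μ := 0) hne
  rw [← measure_congr (Ioi_ae_eq_Ici (a := z)), ← h1,
    Measure.map_apply (by fun_prop) measurableSet_Ioi]
  congr 1
  ext y
  have hα' : 0 < α⁻¹ := inv_pos.2 hα
  simp only [mem_Iio, mem_preimage, mem_Ioi]
  constructor <;> intro hy <;> nlinarith

lemma card_exceed_antitone {Ω : Type*} (X : ℕ → Ω → ℝ) (n : ℕ) (ω : Ω) :
    Antitone fun x : ℝ => ((Finset.Icc 1 n).filter fun i => x < X i ω).card := fun _ _ hxy =>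
  Finset.card_le_card (Finset.monotone_filter_right _ fun _ _ hi => lt_of_le_of_lt hxy hi)

lemma nonneg_of_card_exceed_lt {Ω : Type*} {X : ℕ → Ω → ℝ} (hpos : ∀ i ω, 0 ≤ X i ω) {n k : ℕ} (hkn : k ≤ n)
    {ω : Ω} {x : ℝ} (hx : ((Finset.Icc 1 n).filter fun i => x < X i ω).card < k) : 0 ≤ x := by
  by_contra! h0
  rw [Finset.filter_true_of_mem fun i _ => h0.trans_le (hpos i ω)] at hx
  simp at hx
  omega

lemma orderStat_nonneg {Ω : Type*} {X : ℕ → Ω → ℝ} (hpos : ∀ i ω, 0 ≤ X i ω) {n k : ℕ} (hkn : k ≤ n)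
    (ω : Ω) : 0 ≤ orderStat n k X ω :=
  Real.sInf_nonneg fun _ hx => nonneg_of_card_exceed_lt hpos hkn hx

lemma orderStat_le_iff {Ω : Type*} {X : ℕ → Ω → ℝ} (hpos : ∀ i ω, 0 ≤ X i ω) {n k : ℕ} (hk : 0 < k)
    (hkn : k ≤ n) (ω : Ω) (y : ℝ) :
    orderStat n k X ω ≤ y ↔ ((Finset.Icc 1 n).filter fun i => y < X i ω).card < k := by
  have hbdd : BddBelow {x : ℝ | ((Finset.Icc 1 n).filter fun i => x < X i ω).card < k} :=
    ⟨0, fun x hx => nonneg_of_card_exceed_lt hpos hkn hx⟩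
  refine ⟨fun h => ?_, fun h => csInf_le hbdd h⟩
  have hne : {x : ℝ | ((Finset.Icc 1 n).filter fun i => x < X i ω).card < k}.Nonempty := by
    refine ⟨∑ i ∈ Finset.Icc 1 n, X i ω, ?_⟩
    rw [mem_ofPred_eq, Finset.filter_false_of_mem fun i hi =>
      not_lt.2 (Finset.single_le_sum (f := fun i => X i ω) (fun i _ => hpos i ω) hi)]
    simpa using hk
  have hev : ∀ᶠ x in 𝓝[>] y, ∀ i ∈ (Finset.Icc 1 n).filter fun i => y < X i ω, x < X i ω :=
    (Filter.eventually_all_finset _).2 fun i hi =>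
      nhdsWithin_le_nhds (eventually_lt_nhds (Finset.mem_filter.1 hi).2)
  obtain ⟨x, hx, hyx⟩ := (hev.and self_mem_nhdsWithin).exists
  obtain ⟨s, hs, hsx⟩ := exists_lt_of_csInf_lt hne (lt_of_le_of_lt h hyx)
  refine lt_of_le_of_lt (Finset.card_le_card fun i hi => ?_)
    (lt_of_le_of_lt (card_exceed_antitone X n ω hsx.le) hs)
  exact Finset.mem_filter.2 ⟨(Finset.mem_filter.1 hi).1, hx i hi⟩

lemma card_exceed_eq_sum {Ω : Type*} (X : ℕ → Ω → ℝ) (n : ℕ) (y : ℝ) (ω : Ω) :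
    (((Finset.Icc 1 n).filter fun i => y < X i ω).card : ℝ)
      = ∑ i ∈ Finset.Icc 1 n, if y < X i ω then (1 : ℝ) else 0 := by
  simp

lemma measurable_sum_exceed {X : ℕ → Ω → ℝ} (hX : ∀ i, Measurable (X i)) (n : ℕ) (y : ℝ) :
    Measurable fun ω => ∑ i ∈ Finset.Icc 1 n, if y < X i ω then (1 : ℝ) else 0 :=
  Finset.measurable_fun_sum _ fun i _ => measurable_exceed hX i y

lemma measurable_orderStat {X : ℕ → Ω → ℝ} (hX : ∀ i, Measurable (X i))
    (hpos : ∀ i ω, 0 ≤ X i ω) {n k : ℕ} (hk : 0 < k) (hkn : k ≤ n) :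
    Measurable (orderStat n k X) := by
  refine measurable_of_Iic fun y => ?_
  have : orderStat n k X ⁻¹' Iic y
      = {ω | (∑ i ∈ Finset.Icc 1 n, if y < X i ω then (1 : ℝ) else 0) < k} := by
    ext ω
    rw [mem_preimage, mem_Iic, orderStat_le_iff hpos hk hkn, mem_ofPred_eq,
      ← card_exceed_eq_sum, Nat.cast_lt]
  rw [this]
  exact measurableSet_lt (measurable_sum_exceed hX n y) measurable_const

lemma le_logSpacing_iff {Ω : Type*} {X : ℕ → Ω → ℝ} (hpos : ∀ i ω, 0 ≤ X i ω) {n k : ℕ} (hk : 0 < k)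
    (hkn : k ≤ n) {b z : ℝ} (hb : 0 ≤ Real.log b - z / Real.sqrt k) (ω : Ω) :
    z ≤ -(Real.sqrt k) * (Real.log (orderStat n k X ω) - Real.log b) ↔
      (∑ i ∈ Finset.Icc 1 n, if Real.exp (Real.log b - z / Real.sqrt k) < X i ω
        then (1 : ℝ) else 0) < k := by
  have hs : 0 < Real.sqrt k := Real.sqrt_pos.2 (Nat.cast_pos.2 hk)
  rw [← card_exceed_eq_sum, Nat.cast_lt, ← orderStat_le_iff hpos hk hkn]
  have h1 : z ≤ -(Real.sqrt k) * (Real.log (orderStat n k X ω) - Real.log b) ↔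
      Real.log (orderStat n k X ω) ≤ Real.log b - z / Real.sqrt k := by
    rw [le_sub_comm, div_le_iff₀ hs]
    constructor <;> intro h <;> linarith
  rw [h1]
  rcases (orderStat_nonneg hpos hkn ω).eq_or_lt with h0 | h0
  · rw [← h0, Real.log_zero]
    exact ⟨fun _ => (Real.exp_pos _).le, fun _ => hb⟩
  · exact Real.log_le_iff_le_exp h0

lemma tendsto_measure_neg_of_charFun [IsProbabilityMeasure (ℙ : Measure Ω)] {W : ℕ → Ω → ℝ}
    (hW : ∀ n, Measurable (W n)) {m v : ℝ} (hv : 0 < v)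
    (h : ∀ θ : ℝ, Tendsto (fun n => ∫ ω, Complex.exp ((θ * W n ω : ℝ) * Complex.I)) atTop
      (𝓝 (Complex.exp (θ * m * Complex.I - v * θ ^ 2 / 2)))) :
    Tendsto (fun n => (ℙ : Measure Ω) {ω | W n ω < 0}) atTop
      (𝓝 (gaussianReal m v.toNNReal (Iio 0))) := by
  let P : ℕ → ProbabilityMeasure ℝ := fun n =>
    ⟨Measure.map (W n) (ℙ : Measure Ω), Measure.isProbabilityMeasure_map (hW n).aemeasurable⟩
  let Q : ProbabilityMeasure ℝ := ⟨gaussianReal m v.toNNReal, inferInstance⟩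
  have hlim : Tendsto P atTop (𝓝 Q) := by
    rw [ProbabilityMeasure.tendsto_iff_tendsto_charFun]
    intro θ
    change Tendsto (fun n => charFun (Measure.map (W n) ℙ) θ) atTop
      (𝓝 (charFun (gaussianReal m v.toNNReal) θ))
    rw [charFun_gaussianReal, Real.coe_toNNReal _ hv.le]
    refine (h θ).congr fun n => ?_
    rw [charFun_apply_real, integral_map (hW n).aemeasurable (by fun_prop)]
    simp only [Complex.ofReal_mul]
  have hne : v.toNNReal ≠ 0 := by
    rw [Ne, Real.toNNReal_eq_zero, not_le]
    exact hv
  have := nullSingletonClass_gaussianReal (μ := m) hne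
  have h0 : (Q : Measure ℝ) (frontier (Iio 0)) = 0 := by
    rw [frontier_Iio]
    exact measure_singleton (μ := gaussianReal m v.toNNReal) 0
  refine (ProbabilityMeasure.tendsto_measure_of_null_frontier_of_tendsto' hlim h0).congr fun n => ?_
  change Measure.map (W n) ℙ (Iio 0) = _
  rw [Measure.map_apply (hW n) measurableSet_Iio]
  rfl

/-- Asymptotic normality of the normalized log-spacing of the `k`-th largest order
statistic: `ζ_n = -√k (log X_(k) - log b(n/k)) ⇒ N(0, α⁻²(1+ω))`. -/
theorem order_stat_log_spacing_gaussian
    {Ω : Type*} [MeasureSpace Ω] [IsProbabilityMeasure (ℙ : Measure Ω)]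
    (X : ℕ → Ω → ℝ) (hmeas : ∀ i, Measurable (X i)) (hpos : ∀ i ω, 0 ≤ X i ω)
    (hstat : IsStationary X)
    (α : ℝ) (hα : 0 < α) (l : ℝ → ℝ)
    (hF : ParetoTail (Measure.map (X 1) (ℙ : Measure Ω)) α l)
    (k r : ℕ → ℕ) (hk : TailFraction k)
    (hA1 : CondA1 X k r)
    (g : ℝ → ℝ) (K γ A : ℝ)
    (hA2 : CondA2 l g K γ A (quantileB (Measure.map (X 1) (ℙ : Measure Ω))) k)
    (χ ωc : ℝ)
    (hA3 : CondA3 X (quantileB (Measure.map (X 1) (ℙ : Measure Ω))) k r α χ ωc) :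
    TendstoInLaw
      (fun n ω => -(Real.sqrt (k n)) *
        (Real.log (orderStat n (k n) X ω) - Real.log ((quantileB (Measure.map (X 1) (ℙ : Measure Ω))) ((n : ℝ) / k n))))
      (gaussianReal 0 (Real.toNNReal (α⁻¹ ^ 2 * (1 + ωc)))) := by
  have hv : 0 < 1 + ωc := by linarith [hA3.2.1]
  have hμp : IsProbabilityMeasure (Measure.map (X 1) (ℙ : Measure Ω)) :=
    Measure.isProbabilityMeasure_map (hmeas 1).aemeasurable
  have hs := tendsto_sqrt_atTop_of_tailFraction hk
  have hk0 : ∀ᶠ n in atTop, 0 < k n := by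
    filter_upwards [hk.1.eventually_gt_atTop 0] with n hn
    exact_mod_cast hn
  have hkn : ∀ᶠ n in atTop, k n ≤ n := by
    filter_upwards [hk0, (tendsto_ratio_atTop_of_tailFraction hk).eventually_gt_atTop 1]
      with n h0 h1
    rw [one_lt_div (Nat.cast_pos.2 h0)] at h1
    exact_mod_cast h1.le
  refine tendstoInLaw_of_tendsto_Ici ?_ fun z => ?_
  · filter_upwards [hk0, hkn] with n h0 h1
    exact ((Real.measurable_log.comp (measurable_orderStat hmeas hpos h0 h1)).sub_const _).const_mul _
  · rw [← gaussianReal_Iio_zero_eq hα z hv]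
    have hlog : Tendsto (fun n : ℕ => Real.log (quantileB (Measure.map (X 1) (ℙ : Measure Ω))
        ((n : ℝ) / k n)) + -(z / Real.sqrt (k n))) atTop atTop :=
      (Real.tendsto_log_atTop.comp (tendsto_quantileB_ratio hF hk)).atTop_add
        (tendsto_const_nhds.div_atTop hs).neg
    refine (tendsto_measure_neg_of_charFun (fun n => ((measurable_sum_exceed hmeas n _).sub_const
      _).div_const _) hv fun θ =>
        tendsto_charFun_count hmeas hpos hstat hF hk hA1 hA2 hA3 z θ).congr' ?_
    filter_upwards [hk0, hkn, hlog.eventually_ge_atTop 0] with n h0 h1 h2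
    congr 1
    ext ω
    rw [mem_ofPred_eq, mem_ofPred_eq,
      le_logSpacing_iff hpos h0 h1 (by rwa [sub_eq_add_neg]) ω,
      div_lt_iff₀ (Real.sqrt_pos.2 (Nat.cast_pos.2 h0)), zero_mul, sub_neg]

end TailCusum
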